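/- arXiv:1401.3325 — 2 statements merged into one kernel-verified Lean document; each statement's English description precedes it below -/
import Mathlib

section
/- Let ⟨{a,b}, C, d, O, v, (<, <^{-1})⟩ be a two-player antagonistic infinite sequential game where O is finite and < is a strict linear order on O (player a's preference is <, player b's is <^{-1}), and let Γ be a collection of subsets of C^ω. Assume: (1) for every O' ⊆ O and every γ ∈ C*, the set {α ∈ C^ω | v(γα) ∈ O'} belongs to Γ, where γα denotes concatenation; (2) every two-player win/lose game ⟨C, D, W⟩ with D ⊆ C* and W ∈ Γ is determined. Then the game has a subgame perfect equilibrium. -/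
namespace SeqGame

variable {A C O : Type*}

/-- The length-`n` prefix of an infinite sequence, as a list. -/
def pre (p : ℕ → C) (n : ℕ) : List C := List.ofFn (fun i : Fin n => p i)

/-- The length-`n` history of the play induced by the strategy profile `σ` starting at `γ`. -/
def hist (σ : List C → C) (γ : List C) : ℕ → List C
  | 0 => []
  | n + 1 => hist σ γ n ++
      [if h : n < γ.length then γ.get ⟨n, h⟩ else σ (hist σ γ n)]

/-- The play `p^γ(σ)` induced by the strategy profile `σ` starting at `γ`. -/
def play (σ : List C → C) (γ : List C) (n : ℕ) : C :=
  if h : n < γ.length then γ.get ⟨n, h⟩ else σ (hist σ γ n)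

/-- `σ'` is an `a`-deviation of the strategy profile `σ`. -/
def Dev (d : List C → A) (a : A) (σ σ' : List C → C) : Prop :=
  ∀ h : List C, d h ≠ a → σ' h = σ h

/-- `r` is a strict weak order: irreflexive, transitive, with transitive incomparability. -/
def SWO (r : O → O → Prop) : Prop :=
  (∀ x, ¬ r x x) ∧ (∀ x y z, r x y → r y z → r x z) ∧
  (∀ x y z, ¬ r x y → ¬ r y z → ¬ r x z)

/-- `r` is a strict linear order: irreflexive, transitive and total. -/
def SLO (r : O → O → Prop) : Prop :=
  (∀ x, ¬ r x x) ∧ (∀ x y z, r x y → r y z → r x z) ∧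
  (∀ x y, x = y ∨ r x y ∨ r y x)

/-- The play `p` is consistent with the strategy `s` of player `a` from `γ` on. -/
def Consistent (d : List C → A) (a : A) (s : List C → C) (γ : List C) (p : ℕ → C) : Prop :=
  pre p γ.length = γ ∧ ∀ n, γ.length ≤ n → d (pre p n) = a → p n = s (pre p n)

/-- The guarantee `g_a(γ, s)` of player `a` (with preference `r`) by strategy `s` at `γ`. -/
def gua (d : List C → A) (v : (ℕ → C) → O) (r : O → O → Prop) (a : A)
    (γ : List C) (s : List C → C) : Set O :=
  {o | ∃ p : ℕ → C, Consistent d a s γ p ∧ ¬ r o (v p)}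

/-- The best guarantee `G_a(γ)` of player `a` (with preference `r`) at `γ`. -/
def Gua (d : List C → A) (v : (ℕ → C) → O) (r : O → O → Prop) (a : A) (γ : List C) : Set O :=
  ⋂ s : List C → C, gua d v r a γ s

/-- `I` is a `r`-terminal interval: `o ∈ I` and `¬(o' ≺ o)` imply `o' ∈ I`. -/
def Terminal (r : O → O → Prop) (I : Set O) : Prop :=
  ∀ o ∈ I, ∀ o', ¬ r o' o → o' ∈ I

/-- `I` is a `r`-extremal interval. -/
def Extremal (r : O → O → Prop) (I : Set O) : Prop :=
  Terminal r I ∨ Terminal (fun x y => r y x) I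

/-- `γ C^ω`: the set of plays extending the finite sequence `γ`. -/
def ext (γ : List C) : Set (ℕ → C) := {p | pre p γ.length = γ}

/-- Concatenation `γ·α` of a finite sequence and an infinite one. -/
def cat (γ : List C) (α : ℕ → C) : ℕ → C :=
  fun n => if h : n < γ.length then γ.get ⟨n, h⟩ else α (n - γ.length)

/-- The two-player win/lose game `⟨C, D, W⟩` is determined. -/
def Determined (D : Set (List C)) (W : Set (ℕ → C)) : Prop :=
  (∃ s : List C → C, ∀ p : ℕ → C, (∀ n, pre p n ∈ D → p n = s (pre p n)) → p ∈ W) ∨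
  (∃ t : List C → C, ∀ p : ℕ → C, (∀ n, pre p n ∉ D → p n = t (pre p n)) → p ∉ W)

/-- In a two-player game (`true` is player `a`, `false` is player `b`) with antagonistic
preferences, the preference of each player derived from the preference `r` of player `a`. -/
def rel (r : O → O → Prop) : Bool → O → O → Prop
  | true => r
  | false => fun o o' => r o' o

end SeqGame


namespace SeqGame

variable {A C O : Type*}

@[simp] theorem pre_length (p : ℕ → C) (n : ℕ) : (pre p n).length = n := by simp [pre]

theorem pre_succ (p : ℕ → C) (n : ℕ) : pre p (n + 1) = pre p n ++ [p n] := by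
  simp only [pre, List.ofFn_succ_last, Fin.val_castSucc, Fin.val_last]

theorem pre_getElem? (p : ℕ → C) {m n : ℕ} (h : m < n) : (pre p n)[m]? = some (p m) := by
  simp [pre, h]

theorem pre_take (p : ℕ → C) {m n : ℕ} (h : m ≤ n) : (pre p n).take m = pre p m := by
  apply List.ext_getElem
  · simp [h]
  · intro i h₁ h₂
    simp [pre]

theorem pre_congr_of_le {p q : ℕ → C} {m n : ℕ} (h : pre p n = pre q n) (hm : m ≤ n) :
    pre p m = pre q m := by
  rw [← pre_take p hm, h, pre_take q hm]

theorem eq_of_pre_eq {p q : ℕ → C} {m n : ℕ} (h : pre p n = pre q n) (hm : m < n) :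
    p m = q m := by
  have h' := congrArg (fun l => l[m]?) h
  simpa [pre_getElem? _ hm] using h'

theorem pre_add (p : ℕ → C) (k n : ℕ) :
    pre p (k + n) = pre p k ++ pre (fun i => p (k + i)) n := by
  induction n with
  | zero => simp [pre]
  | succ n ih => rw [← Nat.add_assoc, pre_succ, ih, pre_succ, List.append_assoc]

theorem cat_shift {p : ℕ → C} {γ : List C} (h : pre p γ.length = γ) :
    cat γ (fun i => p (γ.length + i)) = p := by
  funext n
  unfold cat
  split_ifs with hn
  · have h' := pre_getElem? p hn
    rw [h] at h'
    simpa [List.getElem?_eq_getElem hn] using h'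
  · simp only
    congr 1
    omega

theorem pre_play (σ : List C → C) (γ : List C) (n : ℕ) : pre (play σ γ) n = hist σ γ n := by
  induction n with
  | zero => simp [pre, hist]
  | succ n ih => rw [pre_succ, ih, hist, play]

theorem pre_play_length (σ : List C → C) (γ : List C) : pre (play σ γ) γ.length = γ := by
  apply List.ext_getElem
  · simp
  · intro i h₁ h₂
    simp [pre, play]

theorem play_eq (σ : List C → C) (γ : List C) {n : ℕ} (h : γ.length ≤ n) :
    play σ γ n = σ (pre (play σ γ) n) := by
  rw [pre_play, play, dif_neg (by omega)]

theorem consistent_play {d : List C → A} {a : A} {s σ : List C → C}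
    (h : ∀ η, d η = a → σ η = s η) (γ : List C) : Consistent d a s γ (play σ γ) :=
  ⟨pre_play_length σ γ, fun n hn hd => by rw [play_eq σ γ hn, h _ hd]⟩

/-- Determinacy of the win/lose games played after a history, in terms of that history. -/
theorem determined_from {d : List C → Bool} {v : (ℕ → C) → O} {Q : Set O} {γ : List C}
    (h : Determined {α | d (γ ++ α) = true} {α : ℕ → C | v (cat γ α) ∈ Q}) :
    (∃ s, ∀ p, Consistent d true s γ p → v p ∈ Q) ∨
    (∃ t, ∀ p, Consistent d false t γ p → v p ∉ Q) := by
  have key : ∀ (p : ℕ → C), pre p γ.length = γ → ∀ n,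
      pre p (γ.length + n) = γ ++ pre (fun i => p (γ.length + i)) n := by
    intro p hp n
    rw [pre_add, hp]
  rcases h with ⟨s, hs⟩ | ⟨t, ht⟩
  · refine Or.inl ⟨fun η => s (η.drop γ.length), fun p ⟨hp, hc⟩ => ?_⟩
    have h' := hs (fun i => p (γ.length + i)) (fun n hn => by
      have := hc (γ.length + n) (by omega) (by rw [key p hp]; exact hn)
      simpa [key p hp] using this)
    simpa [cat_shift hp] using h'
  · refine Or.inr ⟨fun η => t (η.drop γ.length), fun p ⟨hp, hc⟩ => ?_⟩
    have h' := ht (fun i => p (γ.length + i)) (fun n hn => by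
      have := hc (γ.length + n) (by omega) (by
        rw [key p hp]; exact Bool.eq_false_of_not_eq_true hn)
      simpa [key p hp] using this)
    simpa [cat_shift hp] using h'

/-- The prefix of length `k` of `γ` has the same value as `γ`, and `γ` follows from there on the
strategy that `S` assigns to this prefix. -/
def IsAnchor (d : List C → A) (a : A) (V : List C → O) (S : List C → List C → C)
    (γ : List C) (k : ℕ) : Prop :=
  k ≤ γ.length ∧ V (γ.take k) = V γ ∧ ∀ m, k ≤ m → m < γ.length → d (γ.take m) = a →
    γ[m]? = some (S (γ.take k) (γ.take m))

theorem isAnchor_pre {d : List C → A} {a : A} {V : List C → O} {S : List C → List C → C}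
    {p : ℕ → C} {n k : ℕ} :
    IsAnchor d a V S (pre p n) k ↔ k ≤ n ∧ V (pre p k) = V (pre p n) ∧
      ∀ m, k ≤ m → m < n → d (pre p m) = a → p m = S (pre p k) (pre p m) := by
  unfold IsAnchor
  rw [pre_length]
  refine and_congr_right fun hk => ?_
  rw [pre_take p hk]
  refine and_congr_right fun _ => forall_congr' fun m => forall_congr' fun _ =>
    forall_congr' fun hm => ?_
  rw [pre_take p hm.le, pre_getElem? p hm, Option.some_inj]

theorem isAnchor_length (d : List C → A) (a : A) (V : List C → O) (S : List C → List C → C)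
    (γ : List C) : IsAnchor d a V S γ γ.length :=
  ⟨le_rfl, by rw [List.take_length], fun m h₁ h₂ => by omega⟩

open Classical in
/-- If `V γ` is the best outcome that player `a` can guarantee from `γ`, for every `γ`, then a
single strategy guarantees all of them. -/
theorem exists_uniform_strategy [LinearOrder O] [WellFoundedGT O] (d : List C → A) (a : A)
    (v : (ℕ → C) → O) (V : List C → O)
    (hV : ∀ γ, ∃ s, ∀ p, Consistent d a s γ p → V γ ≤ v p)
    (hmax : ∀ γ o, (∃ s, ∀ p, Consistent d a s γ p → o ≤ v p) → o ≤ V γ) :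
    ∃ s, ∀ γ p, Consistent d a s γ p → V γ ≤ v p := by
  choose S hS using hV
  have hex : ∀ γ, ∃ k, IsAnchor d a V S γ k := fun γ => ⟨_, isAnchor_length d a V S γ⟩
  refine ⟨fun γ => S (γ.take (Nat.find (hex γ))) γ, fun γ p ⟨hp, hc⟩ => ?_⟩
  set K : ℕ → ℕ := fun n => Nat.find (hex (pre p n)) with hK
  have hKa : ∀ n, IsAnchor d a V S (pre p n) (K n) := fun n => Nat.find_spec (hex (pre p n))
  have hKn : ∀ n, K n ≤ n := fun n => (isAnchor_pre.1 (hKa n)).1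
  have hfollow : ∀ n, γ.length ≤ n → ∀ m, K n ≤ m → m < n + 1 → d (pre p m) = a →
      p m = S (pre p (K n)) (pre p m) := by
    intro n hn m h₁ h₂ hd
    rcases Nat.lt_succ_iff_lt_or_eq.1 h₂ with h | rfl
    · exact (isAnchor_pre.1 (hKa n)).2.2 m h₁ h hd
    · have := hc m hn hd
      simp only at this
      rw [this]
      change S ((pre p m).take (K m)) _ = _
      rw [pre_take p (hKn m)]
  have hstep : ∀ n, γ.length ≤ n → V (pre p n) ≤ V (pre p (n + 1)) := by
    intro n hn
    rw [← (isAnchor_pre.1 (hKa n)).2.1]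
    refine hmax _ _ ⟨S (pre p (K n)), fun q ⟨hq, hqc⟩ => hS _ _ ?_⟩
    rw [pre_length] at hq hqc
    have hkn := hKn n
    refine ⟨by rw [pre_length]; exact pre_congr_of_le hq (by omega), fun m hm hd => ?_⟩
    rw [pre_length] at hm
    by_cases h : n + 1 ≤ m
    · exact hqc m h hd
    · have e := pre_congr_of_le hq (show m ≤ n + 1 by omega)
      rw [eq_of_pre_eq hq (by omega), e]
      exact hfollow n hn m hm (by omega) (e ▸ hd)
  have hmono : Monotone (fun n => V (pre p (γ.length + n))) :=
    monotone_nat_of_le_succ fun n => hstep _ (by omega)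
  obtain ⟨n₀, hn₀⟩ := WellFoundedGT.monotone_chain_condition ⟨_, hmono⟩
  have hconst : ∀ n, γ.length + n₀ ≤ n → V (pre p n) = V (pre p (γ.length + n₀)) := by
    intro n hn
    have := hn₀ (n - γ.length) (by omega)
    simp only [OrderHom.coe_mk] at this
    rw [this, Nat.add_sub_cancel' (by omega)]
  have hKstep : ∀ n, γ.length + n₀ ≤ n → K (n + 1) ≤ K n := by
    intro n hn
    refine Nat.find_min' _ (isAnchor_pre.2 ⟨by have := hKn n; omega, ?_, hfollow n (by omega)⟩)
    rw [(isAnchor_pre.1 (hKa n)).2.1, hconst n hn, hconst (n + 1) (by omega)]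
  have hanti : Antitone (fun n => K (γ.length + n₀ + n)) :=
    antitone_nat_of_succ_le fun n => hKstep _ (Nat.le_add_right _ n)
  obtain ⟨n₁, hn₁⟩ := WellFoundedLT.antitone_chain_condition hanti
  set N := γ.length + n₀ + n₁ with hN
  have hKN : ∀ n, N ≤ n → K n = K N := by
    intro n hn
    have := hn₁ (n - (γ.length + n₀)) (by omega)
    rw [hN, this, Nat.add_sub_cancel' (by omega)]
  have hcons : Consistent d a (S (pre p (K N))) (pre p (K N)) p := by
    refine ⟨by rw [pre_length], fun m hm hd => ?_⟩
    rw [pre_length] at hm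
    have hk := hKN (max N (m + 1)) (le_max_left _ _)
    have := (isAnchor_pre.1 (hKa (max N (m + 1)))).2.2 m (by omega) (by omega) hd
    rwa [hk] at this
  calc V γ = V (pre p (γ.length + 0)) := by rw [Nat.add_zero, hp]
    _ ≤ V (pre p (γ.length + (n₀ + n₁))) := hmono (Nat.zero_le _)
    _ = V (pre p (K N)) := by rw [(isAnchor_pre.1 (hKa N)).2.1, hN, Nat.add_assoc]
    _ ≤ v p := hS _ _ hcons

/-- Strategies of the two players that are opposed from a common history have a joint play. -/
theorem exists_consistent (d : List C → Bool) (s t : List C → C) (γ : List C) :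
    ∃ p, Consistent d true s γ p ∧ Consistent d false t γ p :=
  ⟨play (fun η => if d η = true then s η else t η) γ,
    consistent_play (fun η h => by simp [h]) γ, consistent_play (fun η h => by simp [h]) γ⟩

/-- A finite antagonistic game whose threshold games are determined has a value after every
history. -/
theorem exists_value [Nonempty C] [Nonempty O] [Finite O] [LinearOrder O]
    (d : List C → Bool) (v : (ℕ → C) → O) (γ : List C)
    (hdet : ∀ Q : Set O, (∃ s, ∀ p, Consistent d true s γ p → v p ∈ Q) ∨
      (∃ t, ∀ p, Consistent d false t γ p → v p ∉ Q)) :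
    ∃ x, (∃ s, ∀ p, Consistent d true s γ p → x ≤ v p) ∧
      ∃ t, ∀ p, Consistent d false t γ p → v p ≤ x := by
  set G : Set O := {x | ∃ s, ∀ p, Consistent d true s γ p → x ≤ v p} with hG
  have hne : G.Nonempty := by
    obtain ⟨x, hx⟩ := Finite.exists_min (id : O → O)
    exact ⟨x, fun _ => Classical.arbitrary C, fun p _ => hx (v p)⟩
  obtain ⟨x, hxG, hx⟩ := Set.exists_max_image G id (Set.toFinite G) hne
  refine ⟨x, hxG, ?_⟩
  rcases hdet (Set.Ioi x) with ⟨s, hs⟩ | ⟨t, ht⟩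
  · exfalso
    obtain ⟨p, hp, -⟩ := exists_consistent d s s γ
    obtain ⟨y, hy, hmin⟩ := Set.exists_min_image (Set.Ioi x) id (Set.toFinite _) ⟨_, hs p hp⟩
    exact absurd (hx y ⟨s, fun q hq => hmin _ (hs q hq)⟩) (not_le.2 hy)
  · exact ⟨t, fun p hp => not_lt.1 (ht p hp)⟩

theorem exists_subgamePerfect [Nonempty C] [Nonempty O] [Finite O] [LinearOrder O]
    (d : List C → Bool) (v : (ℕ → C) → O)
    (hdet : ∀ (γ : List C) (Q : Set O), (∃ s, ∀ p, Consistent d true s γ p → v p ∈ Q) ∨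
      (∃ t, ∀ p, Consistent d false t γ p → v p ∉ Q)) :
    ∃ σ : List C → C, ∀ (γ : List C) (X : Bool) (σ' : List C → C), Dev d X σ σ' →
      ¬ rel (· < ·) X (v (play σ γ)) (v (play σ' γ)) := by
  choose V hA hB using fun γ => exists_value d v γ (hdet γ)
  obtain ⟨s, hs⟩ := exists_uniform_strategy d true v V hA (fun γ o ⟨s, hs⟩ => by
    obtain ⟨t, ht⟩ := hB γ
    obtain ⟨p, h₁, h₂⟩ := exists_consistent d s t γ
    exact (hs p h₁).trans (ht p h₂))
  obtain ⟨t, ht⟩ := exists_uniform_strategy (O := Oᵒᵈ) d false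
    (fun p => OrderDual.toDual (v p)) (fun γ => OrderDual.toDual (V γ)) hB (fun γ o ⟨t, ht⟩ => by
      obtain ⟨s, hs⟩ := hA γ
      obtain ⟨p, h₁, h₂⟩ := exists_consistent d s t γ
      exact (ht p h₂).trans (OrderDual.toDual_le_toDual.2 (hs p h₁)))
  replace ht : ∀ γ p, Consistent d false t γ p → v p ≤ V γ := ht
  set σ : List C → C := fun η => if d η = true then s η else t η with hσ
  have hσs : ∀ η, d η = true → σ η = s η := fun η h => by simp [hσ, h]
  have hσt : ∀ η, d η = false → σ η = t η := fun η h => by simp [hσ, h]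
  refine ⟨σ, fun γ X σ' hdev => ?_⟩
  cases X with
  | true =>
    refine not_lt.2 ((ht γ _ (consistent_play (fun η h => ?_) γ)).trans
      (hs γ _ (consistent_play hσs γ)))
    rw [hdev η (by simp [h]), hσt η h]
  | false =>
    refine not_lt.2 ((ht γ _ (consistent_play hσt γ)).trans
      (hs γ _ (consistent_play (fun η h => ?_) γ)))
    rw [hdev η (by simp [h]), hσs η h]

/-- The linear order whose strict part is `r`. -/
noncomputable abbrev SLO.toLinearOrder {r : O → O → Prop} (h : SLO r) : LinearOrder O where
  le x y := x = y ∨ r x y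
  lt := r
  le_refl x := Or.inl rfl
  le_trans x y z := by
    rintro (rfl | h₁) (rfl | h₂)
    exacts [Or.inl rfl, Or.inr h₂, Or.inr h₁, Or.inr (h.2.1 _ _ _ h₁ h₂)]
  lt_iff_le_not_ge x y := by
    refine ⟨fun hxy => ⟨Or.inr hxy, ?_⟩, ?_⟩
    · rintro (rfl | h')
      exacts [h.1 _ hxy, h.1 _ (h.2.1 _ _ _ hxy h')]
    · rintro ⟨rfl | h₁, h₂⟩
      exacts [absurd (Or.inl rfl) h₂, h₁]
  le_antisymm x y := by
    rintro (rfl | h₁) (h₂ | h₂)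
    exacts [rfl, rfl, h₂.symm, absurd (h.2.1 _ _ _ h₁ h₂) (h.1 _)]
  le_total x y := by
    rcases h.2.2 x y with h' | h' | h'
    exacts [Or.inl (Or.inl h'), Or.inl (Or.inr h'), Or.inr (Or.inr h')]
  toDecidableLE := Classical.decRel _

end SeqGame

open SeqGame in
/-- existence of subgame perfect equilibria in two-player antagonistic
infinite sequential games with finitely many outcomes, linearly ordered preferences, and
determinacy of the induced win/lose games (player `a` is `true`, player `b` is `false`). -/
theorem stmt10 {C O : Type*} [Nonempty C] [Nonempty O] [Finite O]
    (d : List C → Bool) (v : (ℕ → C) → O) (lt : O → O → Prop)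
    (Γ : Set (Set (ℕ → C)))
    (hlt : SLO lt)
    (h1 : ∀ (O' : Set O) (γ : List C), {α : ℕ → C | v (cat γ α) ∈ O'} ∈ Γ)
    (h2 : ∀ (D : Set (List C)) (W : Set (ℕ → C)), W ∈ Γ → Determined D W) :
    ∃ σ : List C → C, ∀ (γ : List C) (X : Bool) (σ' : List C → C), Dev d X σ σ' →
      ¬ rel lt X (v (play σ γ)) (v (play σ' γ)) := by
  let := hlt.toLinearOrder
  exact exists_subgamePerfect d v fun γ Q => determined_from (h2 _ _ (h1 Q γ))
end

section
/- Let C be a nonempty set, d : C* → {a,b}, and let f : C^ω → [0,1] be Borel measurable, where C^ω carries the product topology induced by the discrete topology on C and the corresponding Borel σ-algebra; consider the two-player zero-sum sequential game in which player a's payoff is f and player b's payoff is 1 − f. Then for every ε > 0 there is an ε-subgame perfect equilibrium: a strategy profile σ such that for every γ ∈ C*, f(p^γ(σ')) ≤ f(p^γ(σ)) + ε for every a-deviation σ' of σ, and f(p^γ(σ')) ≥ f(p^γ(σ)) − ε for every b-deviation σ' of σ. -/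
namespace BorelDet

universe u w

section Basic

variable {V : Type w}

/-- The length-`n` prefix of an infinite sequence, as a list with the latest entry first. -/
def rpre (x : ℕ → V) : ℕ → List V
  | 0 => []
  | n + 1 => x n :: rpre x n

@[simp] theorem length_rpre (x : ℕ → V) (n : ℕ) : (rpre x n).length = n := by
  induction n with
  | zero => rfl
  | succ n ih => simp [rpre, ih]

theorem rpre_suffix (x : ℕ → V) {m n : ℕ} (h : m ≤ n) : rpre x m <:+ rpre x n := by
  induction n, h using Nat.le_induction with
  | base => exact List.suffix_refl _
  | succ n _ ih => exact ih.trans (List.suffix_cons _ _)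

theorem suffix_eq_of_length {l₁ l₂ l : List V} (h₁ : l₁ <:+ l) (h₂ : l₂ <:+ l)
    (h : l₁.length = l₂.length) : l₁ = l₂ :=
  (List.suffix_of_suffix_length_le h₁ h₂ h.le).eq_of_length h

theorem eq_rpre_of_suffix {x : ℕ → V} {n : ℕ} {q : List V} (h : q <:+ rpre x n) :
    q = rpre x q.length := by
  have hl : q.length ≤ n := by simpa using h.length_le
  exact suffix_eq_of_length h (rpre_suffix x hl) (by simp)

theorem rpre_congr {x y : ℕ → V} {n : ℕ} (h : ∀ j < n, x j = y j) : rpre x n = rpre y n := by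
  induction n with
  | zero => rfl
  | succ n ih =>
    rw [rpre, rpre, ih fun j hj => h j (by omega), h n (by omega)]

theorem rpre_inj {x y : ℕ → V} {n : ℕ} (h : rpre x n = rpre y n) : ∀ j < n, x j = y j := by
  induction n with
  | zero => intro j hj; omega
  | succ n ih =>
    intro j hj
    simp only [rpre, List.cons.injEq] at h
    rcases Nat.lt_succ_iff_lt_or_eq.1 hj with h' | rfl
    · exact ih h.2 j h'
    · exact h.1

/-- The suffix of length `m` of a list (the position after `m` moves). -/
def sfx (p : List V) (m : ℕ) : List V := p.drop (p.length - m)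

theorem sfx_suffix (p : List V) (m : ℕ) : sfx p m <:+ p := List.drop_suffix _ _

theorem length_sfx_le (p : List V) (m : ℕ) : (sfx p m).length ≤ p.length :=
  (sfx_suffix p m).length_le

theorem sfx_rpre (x : ℕ → V) {m n : ℕ} (h : m ≤ n) : sfx (rpre x n) m = rpre x m := by
  have := eq_rpre_of_suffix (sfx_suffix (rpre x n) m)
  have hl : (sfx (rpre x n) m).length = m := by simp [sfx]; omega
  rwa [hl] at this

/-- The coordinatewise image of a position. -/
def mp {V W : Type*} (m : ℕ → V → W) : List V → List W
  | [] => []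
  | a :: p => m p.length a :: mp m p

/-- The coordinatewise image of a play. -/
def mpω {V W : Type*} (m : ℕ → V → W) (x : ℕ → V) : ℕ → W := fun n => m n (x n)

@[simp] theorem length_mp (m : ℕ → V → V) (p : List V) : (mp m p).length = p.length := by
  induction p with
  | nil => rfl
  | cons a p ih => simp [mp, ih]

theorem rpre_mpω (m : ℕ → V → V) (x : ℕ → V) (n : ℕ) : rpre (mpω m x) n = mp m (rpre x n) := by
  induction n with
  | zero => rfl
  | succ n ih => simp [mp, rpre, ih, mpω]

theorem mp_mp (m m' : ℕ → V → V) (p : List V) :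
    mp m (mp m' p) = mp (fun n => m n ∘ m' n) p := by
  induction p with
  | nil => rfl
  | cons a p ih => simp [mp, ih]

theorem mp_congr {m m' : ℕ → V → V} {p : List V} (h : ∀ j < p.length, m j = m' j) :
    mp m p = mp m' p := by
  induction p with
  | nil => rfl
  | cons a p ih =>
    simp only [List.length_cons] at h
    rw [mp, mp, h p.length (by omega), ih fun j hj => h j (by omega)]

theorem mp_id {m : ℕ → V → V} {p : List V} (h : ∀ j < p.length, m j = id) : mp m p = p := by
  induction p with
  | nil => rfl
  | cons a p ih =>
    simp only [List.length_cons] at h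
    rw [mp, h p.length (by omega), ih fun j hj => h j (by omega), id]

/-- Nonempty pruned trees of positions. -/
structure IsTree (T : Set (List V)) : Prop where
  nil : [] ∈ T
  tail : ∀ {a p}, a :: p ∈ T → p ∈ T
  ext : ∀ {p}, p ∈ T → ∃ a, a :: p ∈ T

theorem IsTree.suffix {T : Set (List V)} (hT : IsTree T) {p q : List V} (hq : q ∈ T)
    (h : p <:+ q) : p ∈ T := by
  induction q with
  | nil => rwa [List.suffix_nil.1 h]
  | cons a q ih =>
    rcases List.suffix_cons_iff.1 h with rfl | h
    · exact hq
    · exact ih (hT.tail hq) h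

variable [Nonempty V]

/-- The move suggested by `σ` at `p`, replaced by some legal move if it is illegal. -/
noncomputable def leg (T : Set (List V)) (σ : List V → V) (p : List V) : V :=
  open Classical in if σ p :: p ∈ T then σ p else Classical.epsilon fun a => a :: p ∈ T

theorem leg_mem {T : Set (List V)} (hT : IsTree T) (σ : List V → V) {p : List V} (hp : p ∈ T) :
    leg T σ p :: p ∈ T := by
  unfold leg
  split_ifs with h
  · exact h
  · exact Classical.epsilon_spec (hT.ext hp)

theorem leg_eq {T : Set (List V)} {σ : List V → V} {p : List V} (h : σ p :: p ∈ T) :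
    leg T σ p = σ p := if_pos h

theorem leg_congr {T T' : Set (List V)} {σ σ' : List V → V} {p : List V}
    (hT : ∀ q : List V, q.length ≤ p.length + 1 → (q ∈ T ↔ q ∈ T')) (h : σ p = σ' p) :
    leg T σ p = leg T' σ' p := by
  have h₁ : ∀ a, a :: p ∈ T ↔ a :: p ∈ T' := fun a => hT _ (by simp)
  have h₂ : (fun a => a :: p ∈ T) = fun a => a :: p ∈ T' := funext fun a => propext (h₁ a)
  unfold leg
  rw [h, h₂]
  by_cases h₃ : σ' p :: p ∈ T'
  · rw [if_pos h₃, if_pos ((h₁ _).2 h₃)]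
  · rw [if_neg h₃, if_neg fun h₄ => h₃ ((h₁ _).1 h₄)]

/-- `x` is a play of `T` consistent with the strategy `σ` of the player moving at the positions
whose length is `i` modulo `2`. -/
def Cons (T : Set (List V)) (i : ℕ) (σ : List V → V) (x : ℕ → V) : Prop :=
  (∀ n, rpre x n ∈ T) ∧ ∀ n, n % 2 = i → x n = leg T σ (rpre x n)

/-- `T'` covers `T`, leaving the first `k` moves unchanged; `m` maps the moves and `φ` the
strategies. -/
structure Cov (k : ℕ) (T T' : Set (List V)) (m : ℕ → V → V)
    (φ : ℕ → (List V → V) → List V → V) : Prop where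
  agree : ∀ p : List V, p.length ≤ k → (p ∈ T' ↔ p ∈ T)
  m_id : ∀ n < k, m n = id
  map : ∀ p ∈ T', mp m p ∈ T
  φ_id : ∀ i σ p, p.length < k → φ i σ p = σ p
  loc : ∀ i n σ τ, (∀ p : List V, p.length < n → σ p = τ p) →
    ∀ p : List V, p.length < n → φ i σ p = φ i τ p
  lift : ∀ i < 2, ∀ σ x, Cons T i (φ i σ) x → ∃ x', Cons T' i σ x' ∧ mpω m x' = x

theorem Cov.mono {k l : ℕ} {T T' : Set (List V)} {m : ℕ → V → V}
    {φ : ℕ → (List V → V) → List V → V} (h : Cov l T T' m φ) (hkl : k ≤ l) :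
    Cov k T T' m φ where
  agree p hp := h.agree p (by omega)
  m_id n hn := h.m_id n (by omega)
  map := h.map
  φ_id i σ p hp := h.φ_id i σ p (by omega)
  loc := h.loc
  lift := h.lift

theorem Cov.comp {k : ℕ} {T T' T'' : Set (List V)} {m m' : ℕ → V → V}
    {φ φ' : ℕ → (List V → V) → List V → V} (h : Cov k T T' m φ) (h' : Cov k T' T'' m' φ') :
    Cov k T T'' (fun n => m n ∘ m' n) (fun i => φ i ∘ φ' i) where
  agree p hp := (h'.agree p hp).trans (h.agree p hp)
  m_id n hn := by rw [h.m_id n hn, h'.m_id n hn]; rfl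
  map p hp := by rw [← mp_mp]; exact h.map _ (h'.map _ hp)
  φ_id i σ p hp := by simp [h.φ_id i _ p hp, h'.φ_id i _ p hp]
  loc i n σ τ H p hp := h.loc i n _ _ (h'.loc i n _ _ H) p hp
  lift i hi σ x hx := by
    obtain ⟨y, hy, rfl⟩ := h.lift i hi _ _ hx
    obtain ⟨z, hz, rfl⟩ := h'.lift i hi _ _ hy
    exact ⟨z, hz, rfl⟩

end Basic

section Limit

variable {V : Type w} {T : ℕ → Set (List V)} {m : ℕ → ℕ → V → V}
  {φ : ℕ → ℕ → (List V → V) → List V → V} {k : ℕ}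

/-- The limit of a sequence of trees. -/
def limT (T : ℕ → Set (List V)) : Set (List V) := {p | p ∈ T p.length}

/-- The composition of the `j` move maps starting from the one with index `i`. -/
def compM (m : ℕ → ℕ → V → V) : ℕ → ℕ → ℕ → V → V
  | _, 0 => fun _ => id
  | i, j + 1 => fun n => m i n ∘ compM m (i + 1) j n

/-- The composition of the `j` strategy maps starting from the one with index `i`. -/
def compS (φ : ℕ → (List V → V) → List V → V) : ℕ → ℕ → (List V → V) → List V → V
  | _, 0 => id
  | i, j + 1 => φ i ∘ compS φ (i + 1) j

/-- The move map from the limit tree to the `i`-th tree. -/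
def limM (m : ℕ → ℕ → V → V) (i n : ℕ) : V → V := compM m i (n + 1) n

/-- The strategy map from the limit tree to the `i`-th tree. -/
def limS (φ : ℕ → (List V → V) → List V → V) (i : ℕ) (σ : List V → V) (p : List V) : V :=
  compS φ i (p.length + 1) σ p

theorem compM_succ (i j n : ℕ) : compM m i (j + 1) n = m i n ∘ compM m (i + 1) j n := rfl

theorem compM_succ' (i j n : ℕ) :
    compM m i (j + 1) n = compM m i j n ∘ m (i + j) n := by
  induction j generalizing i with
  | zero => rfl
  | succ j ih =>
    rw [compM_succ, ih, compM_succ, show i + 1 + j = i + (j + 1) by omega]; rfl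

theorem compS_succ' (φ : ℕ → (List V → V) → List V → V) (i j : ℕ) :
    compS φ i (j + 1) = compS φ i j ∘ φ (i + j) := by
  induction j generalizing i with
  | zero => rfl
  | succ j ih =>
    rw [compS, ih, compS, show i + 1 + j = i + (j + 1) by omega]; rfl

variable [Nonempty V] (hc : ∀ i, Cov (k + i) (T i) (T (i + 1)) (m i) (φ i))
include hc

theorem compM_eq {i j n : ℕ} (h : n < j) : compM m i j n = limM m i n := by
  induction j, h using Nat.le_induction with
  | base => rfl
  | succ j hj ih =>
    rw [compM_succ', ih, (hc (i + j)).m_id n (by omega)]; rfl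

theorem limM_succ (i n : ℕ) : limM m i n = m i n ∘ limM m (i + 1) n := by
  rw [← compM_eq hc (show n < n + 1 + 1 by omega), compM_succ]; rfl

theorem compS_loc (e i j n : ℕ) {σ τ : List V → V}
    (h : ∀ p : List V, p.length < n → σ p = τ p) :
    ∀ p : List V, p.length < n →
      compS (fun a => φ a e) i j σ p = compS (fun a => φ a e) i j τ p := by
  induction j generalizing i with
  | zero => exact h
  | succ j ih => exact (hc i).loc e n _ _ (ih (i + 1))

theorem compS_eq {e i j : ℕ} {σ : List V → V} {p : List V} (h : p.length < j) :
    compS (fun a => φ a e) i j σ p = limS (fun a => φ a e) i σ p := by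
  induction j, h using Nat.le_induction with
  | base => rfl
  | succ j hj ih =>
    rw [compS_succ', ← ih]
    exact compS_loc hc e i j (p.length + 1)
      (fun q hq => (hc (i + j)).φ_id e σ q (by omega)) p (by omega)

theorem limS_succ (e i : ℕ) (σ : List V → V) :
    limS (fun a => φ a e) i σ = φ i e (limS (fun a => φ a e) (i + 1) σ) := by
  funext p
  rw [← compS_eq hc (show p.length < p.length + 1 + 1 by omega), compS]
  exact (hc i).loc e (p.length + 1) _ _ (fun q hq => compS_eq hc hq) p (by omega)

theorem limS_id {e i : ℕ} {σ : List V → V} {p : List V} (h : p.length < k + i) :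
    limS (fun a => φ a e) i σ p = σ p := by
  suffices H : ∀ j i, p.length < k + i → ∀ q : List V, q.length ≤ p.length →
      compS (fun a => φ a e) i j σ q = σ q from H _ _ h p le_rfl
  intro j
  induction j with
  | zero => intros; rfl
  | succ j ih =>
    intro i hi q hq
    rw [compS, Function.comp, (hc i).φ_id e _ q (by omega)]
    exact ih (i + 1) (by omega) q hq

theorem mem_limT_iff {p : List V} {i : ℕ} (h : p.length ≤ k + i) : p ∈ limT T ↔ p ∈ T i := by
  have key : ∀ {i j : ℕ}, p.length ≤ k + i → i ≤ j → (p ∈ T j ↔ p ∈ T i) := by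
    intro i j hi hij
    induction j, hij using Nat.le_induction with
    | base => rfl
    | succ j hj ih => rw [(hc j).agree p (by omega), ih]
  rcases le_total i p.length with h' | h'
  · exact key h h'
  · exact (key (by omega) h').symm

theorem limT_isTree (hT : ∀ i, IsTree (T i)) : IsTree (limT T) where
  nil := (hT 0).nil
  tail {a p} h := by
    rw [mem_limT_iff hc (i := p.length + 1) (by simp)] at h
    rw [mem_limT_iff hc (i := p.length + 1) (by omega)]
    exact (hT _).tail h
  ext {p} h := by
    rw [mem_limT_iff hc (i := p.length + 1) (by omega)] at h
    obtain ⟨a, ha⟩ := (hT _).ext h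
    exact ⟨a, (mem_limT_iff hc (i := p.length + 1) (by simp)).2 ha⟩

theorem mp_limM_mem {p : List V} (i : ℕ) (hp : p ∈ limT T) : mp (limM m i) p ∈ T i := by
  have key : ∀ j i, p ∈ T (i + j) → mp (compM m i j) p ∈ T i := by
    intro j
    induction j with
    | zero => intro i h; rwa [show mp (compM m i 0) p = p from mp_id fun _ _ => rfl]
    | succ j ih =>
      intro i h
      have := ih (i + 1) (by rwa [show i + 1 + j = i + (j + 1) by omega])
      have := (hc i).map _ this
      rwa [mp_mp] at this
  rw [mp_congr (m' := compM m i p.length) fun j hj => (compM_eq hc hj).symm]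
  exact key _ _ ((mem_limT_iff hc (by omega)).1 hp)

theorem Cov.limit : Cov k (T 0) (limT T) (limM m 0) (fun e => limS (fun a => φ a e) 0) where
  agree p hp := mem_limT_iff hc hp
  m_id n hn := by
    have key : ∀ j i, compM m i j n = id := by
      intro j
      induction j with
      | zero => intro; rfl
      | succ j ih => intro i; rw [compM_succ, ih, (hc i).m_id n (by omega)]; rfl
    exact key _ _
  map p hp := mp_limM_mem hc 0 hp
  φ_id e σ p hp := limS_id hc hp
  loc e n σ τ h p hp := compS_loc hc e 0 _ n h p hp
  lift e he σ x hx := by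
    have step : ∀ i (x : {x // Cons (T i) e (limS (fun a => φ a e) i σ) x}),
        ∃ y : {x // Cons (T (i + 1)) e (limS (fun a => φ a e) (i + 1) σ) x},
          mpω (m i) y.1 = x.1 := by
      rintro i ⟨x, hx⟩
      rw [limS_succ hc] at hx
      obtain ⟨y, hy, h⟩ := (hc i).lift e he _ _ hx
      exact ⟨⟨y, hy⟩, h⟩
    choose nx hnx using step
    let X : ∀ i, {x // Cons (T i) e (limS (fun a => φ a e) i σ) x} :=
      fun i => Nat.rec ⟨x, hx⟩ nx i
    have hX : ∀ i n, m i n ((X (i + 1)).1 n) = (X i).1 n := fun i n => congrFun (hnx i (X i)) n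
    have hst : ∀ i j n, n < k + i → i ≤ j → (X j).1 n = (X i).1 n := by
      intro i j n hn hij
      induction j, hij using Nat.le_induction with
      | base => rfl
      | succ j hj ih => rw [← ih, ← hX j, (hc j).m_id n (by omega)]; rfl
    let y : ℕ → V := fun n => (X (n + 1)).1 n
    have hy : ∀ i n, n ≤ k + i → rpre y n = rpre (X i).1 n := by
      intro i n hn
      refine rpre_congr fun j hj => ?_
      rcases le_total i (j + 1) with h | h
      · exact hst _ _ _ (by omega) h
      · exact (hst _ _ _ (by omega) h).symm
    refine ⟨y, ⟨fun n => ?_, fun n hn => ?_⟩, ?_⟩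
    · rw [mem_limT_iff hc (i := n) (by simp), hy n n (by omega)]
      exact (X n).2.1 n
    · rw [show y n = (X (n + 1)).1 n from rfl, (X (n + 1)).2.2 n hn, ← hy (n + 1) n (by omega)]
      refine leg_congr (fun q hq => ?_) (limS_id hc (by simp; omega))
      simp at hq
      rw [mem_limT_iff hc (i := n + 1) (by omega)]
    · funext n
      have key : ∀ j i, compM m i j n ((X (i + j)).1 n) = (X i).1 n := by
        intro j
        induction j with
        | zero => intro i; rfl
        | succ j ih =>
          intro i
          have := ih (i + 1)
          rw [show i + 1 + j = i + (j + 1) by omega] at this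
          rw [compM_succ, Function.comp, this, hX]
      have := key (n + 1) 0
      rwa [Nat.zero_add] at this

end Limit

section Force

variable {V : Type w}

/-- `Q` is a quasi-strategy, in the tree `S` above `r`, of the player moving at the positions
whose length is `i` modulo `2`. -/
structure QStrat (i : ℕ) (S : Set (List V)) (r : List V) (Q : Set (List V)) : Prop where
  base : r ∈ Q
  sub : ∀ {q}, q ∈ Q → q ∈ S
  above : ∀ {q}, q ∈ Q → r <:+ q
  tail : ∀ {a q}, a :: q ∈ Q → r <:+ q → q ∈ Q
  ext : ∀ {q}, q ∈ Q → ∃ a, a :: q ∈ Q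
  full : ∀ {a q}, q ∈ Q → q.length % 2 ≠ i → a :: q ∈ S → a :: q ∈ Q

theorem QStrat.suffix {i : ℕ} {S Q : Set (List V)} {r : List V} (h : QStrat i S r Q)
    {p q : List V} (hq : q ∈ Q) (hp : p <:+ q) (hr : r <:+ p) : p ∈ Q := by
  induction q with
  | nil => rwa [List.suffix_nil.1 hp]
  | cons a q ih =>
    rcases List.suffix_cons_iff.1 hp with rfl | hp
    · exact hq
    · exact ih (h.tail hq (hr.trans hp)) hp

/-- Player `i` can force a visit to `U` from the given position, with rank at most the given
ordinal. -/
inductive Stage (i : ℕ) (S U : Set (List V)) : Ordinal.{w} → List V → Prop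
  | hit {α p} : p ∈ U → Stage i S U α p
  | mine {α β a p} : p.length % 2 = i → a :: p ∈ S → β < α → Stage i S U β (a :: p) →
      Stage i S U α p
  | theirs {α p} (g : V → Ordinal.{w}) : p.length % 2 ≠ i → (∀ a, a :: p ∈ S → g a < α) →
      (∀ a, a :: p ∈ S → Stage i S U (g a) (a :: p)) → Stage i S U α p

/-- The positions of `S` from which player `i` can force a visit to `U`. -/
def Win (i : ℕ) (S U : Set (List V)) : Set (List V) := {p | ∃ α, Stage i S U α p}

/-- The rank of a position in `Win i S U`. -/
noncomputable def rk (i : ℕ) (S U : Set (List V)) (p : List V) : Ordinal.{w} :=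
  sInf {α | Stage i S U α p}

/-- The positions above `r` reached without visiting `Win i S U`. -/
def Safe (i : ℕ) (S U : Set (List V)) (r : List V) : Set (List V) :=
  {q | q ∈ S ∧ r <:+ q ∧ ∀ q', r <:+ q' → q' <:+ q → q' ∉ Win i S U}

variable {i : ℕ} {S U : Set (List V)}

theorem stage_rk {p : List V} (h : p ∈ Win i S U) : Stage i S U (rk i S U p) p :=
  csInf_mem (s := {α | Stage i S U α p}) h

theorem rk_le {p : List V} {α : Ordinal.{w}} (h : Stage i S U α p) : rk i S U p ≤ α :=
  csInf_le' h

theorem mem_win_of_mem {p : List V} (h : p ∈ U) : p ∈ Win i S U := ⟨0, .hit h⟩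

theorem mem_win_mine {p : List V} {a : V} (hp : p.length % 2 = i) (ha : a :: p ∈ S)
    (h : a :: p ∈ Win i S U) : p ∈ Win i S U :=
  ⟨_, .mine hp ha (Order.lt_succ (rk i S U (a :: p))) (stage_rk h)⟩

theorem mem_win_theirs {p : List V} (hp : p.length % 2 ≠ i)
    (h : ∀ a, a :: p ∈ S → a :: p ∈ Win i S U) : p ∈ Win i S U := by
  refine ⟨⨆ a, (rk i S U (a :: p) + 1), .theirs (fun a => rk i S U (a :: p)) hp (fun a _ => ?_)
    fun a ha => stage_rk (h a ha)⟩
  exact Ordinal.lt_iSup_add_one (fun a => rk i S U (a :: p)) a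

theorem exists_descent {p : List V} (hp : p.length % 2 = i) (h : p ∈ Win i S U) (hU : p ∉ U) :
    ∃ a, a :: p ∈ S ∧ a :: p ∈ Win i S U ∧ rk i S U (a :: p) < rk i S U p := by
  cases stage_rk h with
  | hit h => exact absurd h hU
  | mine _ ha hlt hs => exact ⟨_, ha, ⟨_, hs⟩, (rk_le hs).trans_lt hlt⟩
  | theirs _ h => exact absurd hp h

theorem descent {p : List V} (hp : p.length % 2 ≠ i) (h : p ∈ Win i S U) (hU : p ∉ U) {a : V}
    (ha : a :: p ∈ S) : a :: p ∈ Win i S U ∧ rk i S U (a :: p) < rk i S U p := by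
  cases stage_rk h with
  | hit h => exact absurd h hU
  | mine h => exact absurd h hp
  | theirs g _ hlt hs => exact ⟨⟨_, hs a ha⟩, (rk_le (hs a ha)).trans_lt (hlt a ha)⟩

theorem safe_qstrat (hi : i < 2) {r : List V} (hr : r ∈ S) (hrW : r ∉ Win i S U)
    (hext : ∀ q ∈ S, r <:+ q → ∃ a, a :: q ∈ S)
    (htail : ∀ a q, a :: q ∈ S → r <:+ q → q ∈ S) :
    QStrat (1 - i) S r (Safe i S U r) := by
  have hcons : ∀ {a q}, q ∈ Safe i S U r → a :: q ∈ S → a :: q ∉ Win i S U →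
      a :: q ∈ Safe i S U r := by
    intro a q hq ha hW
    refine ⟨ha, hq.2.1.trans (List.suffix_cons _ _), fun q' h₁ h₂ => ?_⟩
    rcases List.suffix_cons_iff.1 h₂ with rfl | h₂
    · exact hW
    · exact hq.2.2 q' h₁ h₂
  have hmine : ∀ {a q}, q ∈ Safe i S U r → q.length % 2 = i → a :: q ∈ S →
      a :: q ∈ Safe i S U r := fun hq hl ha =>
    hcons hq ha fun h => hq.2.2 _ hq.2.1 (List.suffix_refl _) (mem_win_mine hl ha h)
  refine ⟨⟨hr, List.suffix_refl _, fun q' h₁ h₂ => ?_⟩, fun h => h.1, fun h => h.2.1,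
    fun {a q} h hq => ⟨htail _ _ h.1 hq, hq, fun q' h₁ h₂ =>
      h.2.2 q' h₁ (h₂.trans (List.suffix_cons _ _))⟩, fun {q} hq => ?_, fun {a q} hq hl ha => ?_⟩
  · rwa [suffix_eq_of_length h₂ (List.suffix_refl _)
      (le_antisymm h₂.length_le h₁.length_le)]
  · by_cases hl : q.length % 2 = i
    · obtain ⟨a, ha⟩ := hext q hq.1 hq.2.1
      exact ⟨a, hmine hq hl ha⟩
    · by_contra! hcon
      refine hq.2.2 _ hq.2.1 (List.suffix_refl _) (mem_win_theirs hl fun a ha => ?_)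
      by_contra hW
      exact hcon a (hcons hq ha hW)
  · exact hmine hq (by omega) ha

theorem notMem_of_safe {r q : List V} (h : q ∈ Safe i S U r) : q ∉ U := fun hU =>
  h.2.2 _ h.2.1 (List.suffix_refl _) (mem_win_of_mem hU)

variable [Nonempty V]

/-- A strategy of player `i` forcing a visit to `U` from the positions in `Win i S U`. -/
noncomputable def forceMove (i : ℕ) (S U : Set (List V)) (p : List V) : V :=
  Classical.epsilon fun a => a :: p ∈ S ∧
    (p ∈ Win i S U → p ∉ U → a :: p ∈ Win i S U ∧ rk i S U (a :: p) < rk i S U p)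

theorem forceMove_spec {p : List V} (hp : p.length % 2 = i) (hext : ∃ a, a :: p ∈ S) :
    forceMove i S U p :: p ∈ S ∧ (p ∈ Win i S U → p ∉ U →
      forceMove i S U p :: p ∈ Win i S U ∧
        rk i S U (forceMove i S U p :: p) < rk i S U p) := by
  refine Classical.epsilon_spec (p := fun a => a :: p ∈ S ∧
    (p ∈ Win i S U → p ∉ U → a :: p ∈ Win i S U ∧ rk i S U (a :: p) < rk i S U p)) ?_
  by_cases h : p ∈ Win i S U ∧ p ∉ U
  · obtain ⟨a, h₁, h₂⟩ := exists_descent hp h.1 h.2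
    exact ⟨a, h₁, fun _ _ => h₂⟩
  · obtain ⟨a, ha⟩ := hext
    exact ⟨a, ha, fun h₁ h₂ => absurd ⟨h₁, h₂⟩ h⟩

theorem force_hits {x : ℕ → V} {n₀ : ℕ} (hS : ∀ n ≥ n₀, rpre x n ∈ S)
    (hW : rpre x n₀ ∈ Win i S U)
    (hx : ∀ n ≥ n₀, n % 2 = i → x n = forceMove i S U (rpre x n)) :
    ∃ n ≥ n₀, rpre x n ∈ U := by
  by_contra! hU
  have key : ∀ α : Ordinal.{w}, ∀ n ≥ n₀, rpre x n ∈ Win i S U → rk i S U (rpre x n) = α →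
      False := by
    intro α
    induction α using WellFoundedLT.induction with
    | ind α ih =>
      rintro n hn hW rfl
      have : rpre x (n + 1) ∈ Win i S U ∧
          rk i S U (rpre x (n + 1)) < rk i S U (rpre x n) := by
        by_cases hi : n % 2 = i
        · have := (forceMove_spec (U := U) (p := rpre x n) (by simpa using hi)
            ⟨_, hS (n + 1) (by omega)⟩).2 hW (hU n hn)
          rwa [← hx n hn hi] at this
        · exact descent (by simpa using hi) hW (hU n hn) (hS (n + 1) (by omega))
      exact ih _ this.2 (n + 1) (by omega) this.1 rfl
  exact key _ n₀ le_rfl hW rfl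

/-- `u` is the first position above `r` on the way to `p` that belongs to `U`. -/
def FirstHit (U : Set (List V)) (r p u : List V) : Prop :=
  r <:+ u ∧ u <:+ p ∧ u ∈ U ∧ ∀ u', r <:+ u' → u' <:+ u → u' ∈ U → u' = u

omit [Nonempty V] in
theorem firstHit_iff {x : ℕ → V} {l n n₁ : ℕ} (h₁ : rpre x n₁ ∈ U) (hl : l ≤ n₁)
    (hmin : ∀ j, l ≤ j → j < n₁ → rpre x j ∉ U) (hn : n₁ ≤ n) {u : List V} :
    FirstHit U (rpre x l) (rpre x n) u ↔ u = rpre x n₁ := by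
  constructor
  · rintro ⟨h, hu, huU, hu'⟩
    have e := eq_rpre_of_suffix hu
    have hlu : l ≤ u.length := by simpa using h.length_le
    rcases lt_or_ge u.length n₁ with hlt | hge
    · exact absurd (e ▸ huU) (hmin _ hlu hlt)
    · rw [e] at hu' ⊢
      exact (hu' _ (rpre_suffix x hl) (rpre_suffix x hge) h₁).symm
  · rintro rfl
    refine ⟨rpre_suffix x hl, rpre_suffix x hn, h₁, fun u' h h' hU => ?_⟩
    have e := eq_rpre_of_suffix h'
    have hlu : l ≤ u'.length := by simpa using h.length_le
    have hle : u'.length ≤ n₁ := by simpa using h'.length_le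
    rcases hle.lt_or_eq with hlt | heq
    · exact absurd (e ▸ hU) (hmin _ hlu hlt)
    · rw [e, heq]

omit [Nonempty V] in
theorem not_firstHit {x : ℕ → V} {l n : ℕ} (h : ∀ j, l ≤ j → j ≤ n → rpre x j ∉ U) :
    ¬ ∃ u, FirstHit U (rpre x l) (rpre x n) u := by
  rintro ⟨u, h₁, h₂, h₃, -⟩
  have e := eq_rpre_of_suffix h₂
  have hl : l ≤ u.length := by simpa using h₁.length_le
  have hle : u.length ≤ n := by simpa using h₂.length_le
  exact h _ hl hle (e ▸ h₃)

end Force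

section Cover

/-- Moves that can carry codes of small sets of positions. -/
class Coding (V : Type (u + 1)) where
  fst : V → V
  dec : V → Set (List V)
  enc : V → Set (List V) → V
  fst_enc : ∀ a S, fst (enc a S) = a
  dec_enc : ∀ a (S : Set (List V)), Small.{u} S → dec (enc a S) = S

open Coding

variable {V : Type (u + 1)} [Coding.{u} V]

/-- The move map attaching the codes of `S₁` and `S₂` to the moves with index `K` and `K + 1`. -/
def lf (K : ℕ) (S₁ S₂ : Set (List V)) (n : ℕ) (a : V) : V :=
  if n = K then enc a S₁ else if n = K + 1 then enc a S₂ else a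

/-- The move map forgetting the codes attached to the moves with index `K` and `K + 1`. -/
def unlf (K n : ℕ) (a : V) : V := if n = K ∨ n = K + 1 then fst a else a

theorem unlf_lf (K : ℕ) (S₁ S₂ : Set (List V)) (n : ℕ) (a : V) :
    unlf K n (lf K S₁ S₂ n a) = a := by
  unfold unlf lf
  split_ifs <;> simp_all [fst_enc]

theorem mp_unlf_lf (K : ℕ) (S₁ S₂ : Set (List V)) (p : List V) :
    mp (unlf K) (mp (lf K S₁ S₂) p) = p := by
  rw [mp_mp]
  exact mp_id fun j _ => funext fun a => unlf_lf K S₁ S₂ j a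

theorem mpω_unlf_lf (K : ℕ) (S₁ S₂ : Set (List V)) (x : ℕ → V) :
    mpω (unlf K) (mpω (lf K S₁ S₂) x) = x := funext fun _ => unlf_lf _ _ _ _ _

theorem lf_lt {K n : ℕ} (h : n < K) (S₁ S₂ : Set (List V)) : lf K S₁ S₂ n = id := by
  funext a
  rw [lf, if_neg (by omega), if_neg (by omega), id]

theorem mp_lf_of_le {K : ℕ} {p : List V} (h : p.length ≤ K) (S₁ S₂ : Set (List V)) :
    mp (lf K S₁ S₂) p = p := mp_id fun j hj => lf_lt (by omega) _ _

theorem mp_lf_congr {K : ℕ} {p : List V} {S₁ S₂ S₁' S₂' : Set (List V)}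
    (h₁ : K < p.length → S₁ = S₁') (h₂ : K + 1 < p.length → S₂ = S₂') :
    mp (lf K S₁ S₂) p = mp (lf K S₁' S₂') p := by
  refine mp_congr fun j hj => funext fun a => ?_
  unfold lf
  split_ifs with h h'
  · rw [h₁ (by omega)]
  · rw [h₂ (by omega)]
  · rfl

/-- The positions of `T` above `r` compatible with `u`. -/
def Cone (T : Set (List V)) (r u : List V) : Set (List V) :=
  {q | q ∈ T ∧ r <:+ q ∧ (q <:+ u ∨ u <:+ q)}

/-- The player claims that `u` will be reached. -/
def Hits (T D S₁ : Set (List V)) (r : List V) (S₂ : Set (List V)) : Prop :=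
  ∃ u ∈ S₁, u ∈ D ∧ r <:+ u ∧ S₂ = Cone T r u

/-- The player concedes that `D` will be avoided. -/
def Avoids (D S₁ : Set (List V)) (r : List V) (S₂ : Set (List V)) : Prop :=
  QStrat 1 S₁ r S₂ ∧ ∀ q ∈ S₂, q ∉ D

/-- The position `p`, together with the announced sets `S₁` and `S₂`, is legal in the covering
tree. -/
structure Legal (K : ℕ) (T D S₁ S₂ : Set (List V)) (p : List V) : Prop where
  mem : p ∈ T
  sub₁ : S₁ ⊆ T
  sub₂ : S₂ ⊆ T
  qs : ∀ r, r <:+ p → r.length = K + 1 → QStrat 0 T r S₁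
  opt : ∀ r, r <:+ p → r.length = K + 2 →
    r ∈ S₁ ∧ (Hits T D S₁ r S₂ ∨ Avoids D S₁ r S₂) ∧ p ∈ S₂

/-- The covering tree. -/
def covT (K : ℕ) (T D : Set (List V)) : Set (List V) :=
  {q | ∃ S₁ S₂ p, q = mp (lf K S₁ S₂) p ∧ Legal K T D S₁ S₂ p}

variable {K : ℕ} {T D : Set (List V)}

theorem mp_lf_inj [Small.{u} T] {S₁ S₂ S₁' S₂' : Set (List V)} (h₁ : S₁ ⊆ T) (h₂ : S₂ ⊆ T)
    (h₁' : S₁' ⊆ T) (h₂' : S₂' ⊆ T) {p : List V}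
    (h : mp (lf K S₁ S₂) p = mp (lf K S₁' S₂') p) :
    (K < p.length → S₁ = S₁') ∧ (K + 1 < p.length → S₂ = S₂') := by
  have key : ∀ {a : V} {A B : Set (List V)}, A ⊆ T → B ⊆ T → enc a A = enc a B → A = B := by
    intro a A B hA hB hAB
    have := congrArg dec hAB
    rwa [dec_enc _ _ (small_subset hA), dec_enc _ _ (small_subset hB)] at this
  induction p with
  | nil => simp
  | cons a p ih =>
    simp only [mp, List.cons.injEq] at h
    obtain ⟨i₁, i₂⟩ := ih h.2
    constructor
    · intro hl
      simp only [List.length_cons] at hl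
      rcases (show K = p.length ∨ K < p.length by omega) with he | hlt
      · have := h.1
        rw [← he] at this
        simp only [lf, if_true] at this
        exact key h₁ h₁' this
      · exact i₁ hlt
    · intro hl
      simp only [List.length_cons] at hl
      rcases (show K + 1 = p.length ∨ K + 1 < p.length by omega) with he | hlt
      · have := h.1
        rw [← he] at this
        simp only [lf, if_true, if_neg (show K + 1 ≠ K by omega)] at this
        exact key h₂ h₂' this
      · exact i₂ hlt

omit [Coding.{u} V] in
theorem Legal.of_cons (hT : IsTree T) {S₁ S₂ : Set (List V)} {a : V} {p : List V}
    (h : Legal K T D S₁ S₂ (a :: p)) : Legal K T D S₁ S₂ p where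
  mem := hT.tail h.mem
  sub₁ := h.sub₁
  sub₂ := h.sub₂
  qs r hr hl := h.qs r (hr.trans (List.suffix_cons _ _)) hl
  opt r hr hl := by
    obtain ⟨h₁, h₂, h₃⟩ := h.opt r (hr.trans (List.suffix_cons _ _)) hl
    refine ⟨h₁, h₂, ?_⟩
    rcases h₂ with ⟨u, -, -, -, rfl⟩ | ⟨h₂, -⟩
    · refine ⟨hT.tail h₃.1, hr, ?_⟩
      rcases h₃.2.2 with h | h
      · exact .inl ((List.suffix_cons _ _).trans h)
      · rcases List.suffix_cons_iff.1 h with rfl | h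
        · exact .inl (List.suffix_cons _ _)
        · exact .inr h
    · exact h₂.tail h₃ hr

theorem decode_cons [Small.{u} T] {S₁ S₂ : Set (List V)} {p : List V} {v : V}
    (h : Legal K T D S₁ S₂ p) (hv : v :: mp (lf K S₁ S₂) p ∈ covT K T D) :
    ∃ S₁' S₂' a, v = lf K S₁' S₂' p.length a ∧ Legal K T D S₁' S₂' (a :: p) ∧
      (K < p.length → S₁' = S₁) ∧ (K + 1 < p.length → S₂' = S₂) := by
  obtain ⟨S₁', S₂', q, hq, hL⟩ := hv
  cases q with
  | nil => simp [mp] at hq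
  | cons a q =>
    simp only [mp, List.cons.injEq] at hq
    have e : p = q := by
      rw [← mp_unlf_lf K S₁ S₂ p, hq.2, mp_unlf_lf]
    subst e
    obtain ⟨i₁, i₂⟩ := mp_lf_inj hL.sub₁ hL.sub₂ h.sub₁ h.sub₂ hq.2.symm
    exact ⟨S₁', S₂', a, hq.1, hL, i₁, i₂⟩

theorem decode_long [Small.{u} T] {S₁ S₂ : Set (List V)} {p : List V} {v : V}
    (h : Legal K T D S₁ S₂ p) (hv : v :: mp (lf K S₁ S₂) p ∈ covT K T D)
    (hl : K + 2 ≤ p.length) : Legal K T D S₁ S₂ (v :: p) := by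
  obtain ⟨S₁', S₂', a, rfl, hL, i₁, i₂⟩ := decode_cons h hv
  rw [lf, if_neg (by omega), if_neg (by omega)]
  rwa [← i₁ (by omega), ← i₂ (by omega)]

omit [Coding.{u} V] in
theorem legal_short {p : List V} (hp : p ∈ T) (hl : p.length ≤ K) : Legal K T D ∅ ∅ p where
  mem := hp
  sub₁ := Set.empty_subset _
  sub₂ := Set.empty_subset _
  qs r hr h := by have := hr.length_le; omega
  opt r hr h := by have := hr.length_le; omega

omit [Coding.{u} V] in
theorem legal_succ {p : List V} {S₁ : Set (List V)} (hl : p.length = K + 1)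
    (h : QStrat 0 T p S₁) : Legal K T D S₁ ∅ p where
  mem := h.sub h.base
  sub₁ _ h' := h.sub h'
  sub₂ := Set.empty_subset _
  qs r hr h' := by rwa [hr.eq_of_length (by omega)]
  opt r hr h := by have := hr.length_le; omega

theorem covT_agree {p : List V} (hp : p.length ≤ K) : p ∈ covT K T D ↔ p ∈ T := by
  constructor
  · rintro ⟨S₁, S₂, q, rfl, h⟩
    rw [length_mp] at hp
    rw [mp_lf_of_le hp]
    exact h.mem
  · intro h
    exact ⟨∅, ∅, p, (mp_lf_of_le hp _ _).symm, legal_short h hp⟩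

theorem Legal.mem_covT {S₁ S₂ : Set (List V)} {p : List V} (h : Legal K T D S₁ S₂ p) :
    mp (lf K S₁ S₂) p ∈ covT K T D := ⟨_, _, _, rfl, h⟩

omit [Coding.{u} V] in
theorem qstrat_above (hT : IsTree T) {r : List V} (hr : r ∈ T) (i : ℕ) :
    QStrat i T r {q | q ∈ T ∧ r <:+ q} where
  base := ⟨hr, List.suffix_refl _⟩
  sub h := h.1
  above h := h.2
  tail h h' := ⟨hT.tail h.1, h'⟩
  ext {q} h := by
    obtain ⟨a, ha⟩ := hT.ext h.1
    exact ⟨a, ha, h.2.trans (List.suffix_cons _ _)⟩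
  full h _ h' := ⟨h', h.2.trans (List.suffix_cons _ _)⟩

theorem covT_isTree (hT : IsTree T) : IsTree (covT K T D) where
  nil := (covT_agree (by simp)).2 hT.nil
  tail {v q} h := by
    obtain ⟨S₁, S₂, p, hq, h⟩ := h
    cases p with
    | nil => simp [mp] at hq
    | cons a p =>
      simp only [mp, List.cons.injEq] at hq
      rw [hq.2]
      exact (h.of_cons hT).mem_covT
  ext {q} h := by
    obtain ⟨S₁, S₂, p, rfl, h⟩ := h
    suffices H : ∃ S₁' S₂' a, Legal K T D S₁' S₂' (a :: p) ∧
        (K < p.length → S₁' = S₁) ∧ (K + 1 < p.length → S₂' = S₂) by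
      obtain ⟨S₁', S₂', a, hL, i₁, i₂⟩ := H
      refine ⟨lf K S₁' S₂' p.length a, ?_⟩
      rw [← mp_lf_congr i₁ i₂]
      exact hL.mem_covT
    obtain ⟨a, ha⟩ := hT.ext h.mem
    rcases lt_trichotomy p.length K with hl | hl | hl
    · exact ⟨∅, ∅, a, legal_short ha (by simpa using hl), by omega, by omega⟩
    · exact ⟨_, ∅, a, legal_succ (by simp [hl]) (qstrat_above hT ha 0), by omega, by omega⟩
    rcases (show p.length = K + 1 ∨ K + 2 ≤ p.length by omega) with hl | hl
    · have hQ := h.qs p (List.suffix_refl _) hl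
      obtain ⟨b, hb⟩ := hQ.ext hQ.base
      have hO : ∃ S₂', (Hits T D S₁ (b :: p) S₂' ∨ Avoids D S₁ (b :: p) S₂') ∧ b :: p ∈ S₂' ∧
          S₂' ⊆ T := by
        by_cases hD : ∃ u ∈ S₁, u ∈ D ∧ b :: p <:+ u
        · obtain ⟨u, h₁, h₂, h₃⟩ := hD
          exact ⟨_, .inl ⟨u, h₁, h₂, h₃, rfl⟩, ⟨h.sub₁ hb, List.suffix_refl _, .inl h₃⟩,
            fun _ h => h.1⟩
        · refine ⟨{q | q ∈ S₁ ∧ b :: p <:+ q}, .inr ⟨⟨⟨hb, List.suffix_refl _⟩, fun h => h.1,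
            fun h => h.2, fun h h' => ⟨hQ.tail h.1 ((List.suffix_cons _ _).trans h'), h'⟩,
            fun {q} h => ?_, fun h _ h' => ⟨h', h.2.trans (List.suffix_cons _ _)⟩⟩,
            fun q hq hqD => hD ⟨q, hq.1, hqD, hq.2⟩⟩, ⟨hb, List.suffix_refl _⟩,
            fun _ h' => h.sub₁ h'.1⟩
          obtain ⟨a, ha⟩ := hQ.ext h.1
          exact ⟨a, ha, h.2.trans (List.suffix_cons _ _)⟩
      obtain ⟨S₂', hO, hm, hs⟩ := hO
      refine ⟨S₁, S₂', b, ⟨h.sub₁ hb, h.sub₁, hs, fun r hr hl' => ?_, fun r hr hl' => ?_⟩,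
        by simp, by omega⟩
      · have : r = p := suffix_eq_of_length hr (List.suffix_cons _ _) (by omega)
        rwa [this]
      · have : r = b :: p := hr.eq_of_length (by simp; omega)
        rw [this]
        exact ⟨hb, hO, hm⟩
    · obtain ⟨h₁, h₂, h₃⟩ := h.opt (sfx p (K + 2)) (sfx_suffix _ _) (by simp [sfx]; omega)
      have hE : ∃ a, a :: p ∈ S₂ := by
        rcases h₂ with ⟨u, hu, -, hru, rfl⟩ | ⟨hQ, -⟩
        · rcases h₃.2.2 with hs | hs
          · obtain ⟨t, rfl⟩ := hs
            rcases List.eq_nil_or_concat t with rfl | ⟨t, a, rfl⟩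
            · exact ⟨a, ha, h₃.2.1.trans (List.suffix_cons _ _),
                .inr (by simp)⟩
            · have hs : a :: p <:+ (t ++ [a]) ++ p := ⟨t, by simp⟩
              exact ⟨a, hT.suffix (h.sub₁ hu) (by simp),
                h₃.2.1.trans (List.suffix_cons _ _), .inl (by simp)⟩
          · exact ⟨a, ha, h₃.2.1.trans (List.suffix_cons _ _),
              .inr (hs.trans (List.suffix_cons _ _))⟩
        · exact hQ.ext h₃
      obtain ⟨b, hb⟩ := hE
      refine ⟨S₁, S₂, b, ⟨h.sub₂ hb, h.sub₁, h.sub₂, fun r hr hl' => ?_, fun r hr hl' => ?_⟩,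
        by simp, by simp⟩
      · refine h.qs r ?_ hl'
        rcases List.suffix_cons_iff.1 hr with rfl | hr
        · simp at hl'; omega
        · exact hr
      · rcases List.suffix_cons_iff.1 hr with rfl | hr
        · simp at hl'; omega
        · obtain ⟨h₁, h₂, -⟩ := h.opt r hr hl'
          exact ⟨h₁, h₂, hb⟩

theorem small_covT [Small.{u} T] : Small.{u} (covT K T D) := by
  refine small_subset (s := Set.range fun t : Set T × Set T × T =>
    mp (lf K (Subtype.val '' t.1) (Subtype.val '' t.2.1)) t.2.2.1) ?_
  rintro _ ⟨S₁, S₂, p, rfl, h⟩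
  refine ⟨⟨Subtype.val ⁻¹' S₁, Subtype.val ⁻¹' S₂, ⟨p, h.mem⟩⟩, ?_⟩
  simp only [Subtype.image_preimage_coe]
  rw [Set.inter_eq_right.2 h.sub₁, Set.inter_eq_right.2 h.sub₂]

/-- Membership in the set of plays visiting `D` is decided after `K + 2` moves of the covering
game. -/
theorem covT_decided [Small.{u} T] (hD : ∀ p q, p ∈ D → p <:+ q → q ∈ D) :
    ∃ B : Set (List V), ∀ x, (∀ n, rpre x n ∈ covT K T D) →
      ((∃ n, rpre (mpω (unlf K) x) n ∈ D) ↔ rpre x (K + 2) ∈ B) := by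
  refine ⟨{q | ∃ S₁ S₂ p, q = mp (lf K S₁ S₂) p ∧ p.length = K + 2 ∧ Legal K T D S₁ S₂ p ∧
    Hits T D S₁ p S₂}, fun x hx => ?_⟩
  set y := mpω (unlf K) x with hy
  obtain ⟨S₁, S₂, p, hp, hL⟩ := hx (K + 2)
  have hyp : ∀ {n S₁ S₂ p}, rpre x n = mp (lf K S₁ S₂) p → p = rpre y n := by
    intro n S₁ S₂ p h
    rw [hy, rpre_mpω, h, mp_unlf_lf]
  obtain rfl := hyp hp
  obtain ⟨h₁, h₂, h₃⟩ := hL.opt _ (List.suffix_refl _) (by simp)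
  have hmem : ∀ n ≥ K + 2, rpre x n = mp (lf K S₁ S₂) (rpre y n) ∧
      Legal K T D S₁ S₂ (rpre y n) := by
    intro n hn
    induction n, hn using Nat.le_induction with
    | base => exact ⟨hp, hL⟩
    | succ n hn ih =>
      have h := hx (n + 1)
      rw [rpre, ih.1] at h
      have := decode_long ih.2 h (by simpa using hn)
      have e : x n = y n := by simp [hy, mpω, unlf]; omega
      rw [e] at this
      refine ⟨?_, this⟩
      rw [rpre, rpre, mp, ih.1, e, lf, if_neg (by simp; omega), if_neg (by simp; omega)]
  have hmem₂ : ∀ n ≥ K + 2, rpre y n ∈ S₂ := fun n hn =>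
    ((hmem n hn).2.opt _ (rpre_suffix y hn) (by simp)).2.2
  constructor
  · rintro ⟨n, hn⟩
    refine ⟨S₁, S₂, _, hp, by simp, hL, h₂.resolve_right fun h => ?_⟩
    exact h.2 _ (hmem₂ (max n (K + 2)) (le_max_right _ _))
      (hD _ _ hn (rpre_suffix _ (le_max_left _ _)))
  · rintro ⟨S₁', S₂', p, hp', hl, hL', hH⟩
    obtain rfl := hyp hp'
    obtain ⟨i₁, i₂⟩ := mp_lf_inj hL.sub₁ hL.sub₂ hL'.sub₁ hL'.sub₂ (hp.symm.trans hp')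
    rw [← i₁ (by simp), ← i₂ (by simp)] at hH
    obtain ⟨u, -, hu, hru, rfl⟩ := hH
    refine ⟨max u.length (K + 2), ?_⟩
    rcases (hmem₂ (max u.length (K + 2)) (le_max_right _ _)).2.2 with h | h
    · rw [h.eq_of_length (le_antisymm h.length_le (by simp))]
      exact hu
    · exact hD _ _ hu h

end Cover

section Strategies

open Coding

variable {V : Type (u + 1)} [Coding.{u} V] [Nonempty V]

/-- Translation of a legal strategy of the first player in the covering game, at positions of
length at least `K`. -/
noncomputable def resp0 (K : ℕ) (T D : Set (List V)) (σ : List V → V) (p : List V) : V :=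
  open Classical in
  let r := sfx p (K + 2)
  let S₁ := dec (σ (sfx p K))
  if p.length = K then fst (σ p)
  else if ∃ u, FirstHit D r p u then
    σ (mp (lf K S₁ (Cone T r (Classical.epsilon (FirstHit D r p)))) p)
  else if p ∈ Safe 0 S₁ D r then σ (mp (lf K S₁ (Safe 0 S₁ D r)) p)
  else forceMove 0 S₁ D p

/-- The announcement of `S` at `r` is answered by the claim that `u` will be reached. -/
def Wit (K : ℕ) (T D : Set (List V)) (σ : List V → V) (r u : List V) (S : Set (List V)) : Prop :=
  QStrat 0 T r S ∧ u ∈ S ∧ u ∈ D ∧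
    ∃ b, b :: r <:+ u ∧ σ (mp (lf K S ∅) r) = enc b (Cone T (b :: r) u)

/-- Translation of a legal strategy of the second player in the covering game, at positions of
length at least `K`. -/
noncomputable def resp1 (K : ℕ) (T D : Set (List V)) (σ : List V → V) (p : List V) : V :=
  open Classical in
  let r := sfx p (K + 1)
  let U := {u | ∃ S, Wit K T D σ r u S}
  let u := Classical.epsilon (FirstHit U r p)
  let S₁ := Safe 1 T U r
  if ∃ u, FirstHit U r p u then
    σ (mp (lf K (Classical.epsilon (Wit K T D σ r u)) (Cone T (sfx p (K + 2)) u)) p)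
  else if p ∈ S₁ then
    unlf K p.length (σ (mp (lf K S₁ (dec (σ (mp (lf K S₁ ∅) r)))) p))
  else forceMove 1 T U p

/-- Translation of strategies from the covering game. -/
noncomputable def phi (K : ℕ) (T D : Set (List V)) (i : ℕ) (σ : List V → V) (p : List V) : V :=
  if p.length < K then σ p
  else if i = 0 then resp0 K T D (leg (covT K T D) σ) p
  else resp1 K T D (leg (covT K T D) σ) p

variable {K : ℕ} {T D : Set (List V)}

theorem phi_loc (i n : ℕ) (σ τ : List V → V) (h : ∀ p : List V, p.length < n → σ p = τ p)
    (p : List V) (hp : p.length < n) : phi K T D i σ p = phi K T D i τ p := by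
  have hl : ∀ q : List V, q.length ≤ p.length →
      leg (covT K T D) σ q = leg (covT K T D) τ q := fun q hq =>
    leg_congr (fun _ _ => Iff.rfl) (h q (by omega))
  have hm : ∀ A B, leg (covT K T D) σ (mp (lf K A B) p) = leg (covT K T D) τ (mp (lf K A B) p) :=
    fun A B => hl _ (by simp)
  have hr : ∀ A, leg (covT K T D) σ (mp (lf K A ∅) (sfx p (K + 1))) =
      leg (covT K T D) τ (mp (lf K A ∅) (sfx p (K + 1))) :=
    fun A => hl _ (by rw [length_mp]; exact length_sfx_le _ _)
  have hW : Wit K T D (leg (covT K T D) σ) (sfx p (K + 1)) =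
      Wit K T D (leg (covT K T D) τ) (sfx p (K + 1)) := by
    funext u S
    simp only [Wit, hr]
  simp only [phi, resp0, resp1]
  rw [hl _ (length_sfx_le p K), hW]
  simp only [h p hp, hl p le_rfl, hm, hr]

omit [Coding.{u} V] [Nonempty V] in
theorem Legal.of_suffix (hT : IsTree T) {S₁ S₂ : Set (List V)} {p q : List V}
    (h : Legal K T D S₁ S₂ q) (hp : p <:+ q) : Legal K T D S₁ S₂ p := by
  induction q with
  | nil => rwa [List.suffix_nil.1 hp]
  | cons a q ih =>
    rcases List.suffix_cons_iff.1 hp with rfl | hp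
    · exact h
    · exact ih (h.of_cons hT) hp

omit [Coding.{u} V] [Nonempty V] in
theorem legal_rpre {x : ℕ → V} {S₁ S₂ : Set (List V)} {n : ℕ}
    (hx : rpre x n ∈ T) (h₁ : QStrat 0 T (rpre x (K + 1)) S₁) (h₂ : rpre x (K + 2) ∈ S₁)
    (hO : Hits T D S₁ (rpre x (K + 2)) S₂ ∨ Avoids D S₁ (rpre x (K + 2)) S₂)
    (hS : rpre x n ∈ S₂) : Legal K T D S₁ S₂ (rpre x n) where
  mem := hx
  sub₁ _ h := h₁.sub h
  sub₂ := by
    rcases hO with ⟨u, -, -, -, rfl⟩ | ⟨h, -⟩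
    · exact fun _ h => h.1
    · exact fun _ h' => h₁.sub (h.sub h')
  qs r hr hl := by rwa [eq_rpre_of_suffix hr, hl]
  opt r hr hl := by
    rw [eq_rpre_of_suffix hr, hl]
    exact ⟨h₂, hO, hS⟩

theorem exists_lift (hT : IsTree T) {i : ℕ} {σ' φ : List V → V} {x : ℕ → V}
    {S₁ S₂ : Set (List V)} (hx : Cons T i φ x)
    (hφ : ∀ p : List V, p.length < K → φ p = σ' p)
    (hL : ∀ n ≥ K + 2, Legal K T D S₁ S₂ (rpre x n))
    (h : ∀ n ≥ K, n % 2 = i → lf K S₁ S₂ n (x n) =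
      leg (covT K T D) σ' (mp (lf K S₁ S₂) (rpre x n))) :
    ∃ x', Cons (covT K T D) i σ' x' ∧ mpω (unlf K) x' = x := by
  refine ⟨mpω (lf K S₁ S₂) x, ⟨fun n => ?_, fun n hn => ?_⟩, mpω_unlf_lf _ _ _ _⟩
  · rw [rpre_mpω]
    exact ((hL (max n (K + 2)) (le_max_right _ _)).of_suffix hT
      (rpre_suffix x (le_max_left _ _))).mem_covT
  · rw [rpre_mpω]
    rcases lt_or_ge n K with hlt | hge
    · rw [mp_lf_of_le (by simpa using hlt.le), mpω, lf_lt hlt, id, hx.2 n hn]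
      exact leg_congr (fun q hq => (covT_agree (by simp at hq; omega)).symm)
        (hφ _ (by simpa using hlt))
    · exact h n hge hn

omit [Coding.{u} V] in
theorem Cons.eq_of_mem {i n : ℕ} {φ : List V → V} {x : ℕ → V} (hx : Cons T i φ x) (hn : n % 2 = i)
    {v : V} (hv : φ (rpre x n) = v) (hm : v :: rpre x n ∈ T) : x n = v := by
  rw [hx.2 n hn, leg_eq (by rwa [hv]), hv]

omit [Coding.{u} V] [Nonempty V] in
theorem eq_of_mem_cone {x : ℕ → V} {n n₁ : ℕ} {v : V} {r : List V} (h : n < n₁)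
    (hv : v :: rpre x n ∈ Cone T r (rpre x n₁)) : x n = v := by
  have hs : v :: rpre x n <:+ rpre x n₁ := by
    rcases hv.2.2 with h' | h'
    · exact h'
    · rw [h'.eq_of_length (le_antisymm h'.length_le (by simp; omega))]
  have := eq_rpre_of_suffix hs
  simp only [List.length_cons, length_rpre, rpre, List.cons.injEq] at this
  exact this.1.symm

omit [Coding.{u} V] [Nonempty V] in
theorem rpre_mem_cone {x : ℕ → V} {l n n₁ : ℕ} (hx : rpre x n ∈ T) (hn : l ≤ n) :
    rpre x n ∈ Cone T (rpre x l) (rpre x n₁) :=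
  ⟨hx, rpre_suffix x hn, (le_total n n₁).imp (rpre_suffix x) (rpre_suffix x)⟩

theorem lift0 [Small.{u} T] (hT : IsTree T) (hK : K % 2 = 0) {σ' : List V → V} {x : ℕ → V}
    (hx : Cons T 0 (phi K T D 0 σ') x) :
    ∃ x', Cons (covT K T D) 0 σ' x' ∧ mpω (unlf K) x' = x := by
  classical
  set σ := leg (covT K T D) σ' with hσdef
  have hσ : ∀ q ∈ covT K T D, σ q :: q ∈ covT K T D := fun q hq =>
    leg_mem (covT_isTree hT) σ' hq
  have hφ : ∀ p : List V, p.length < K → phi K T D 0 σ' p = σ' p := fun p hp => by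
    simp [phi, hp]
  have hLK : Legal K T D ∅ ∅ (rpre x K) := legal_short (hx.1 K) (by simp)
  obtain ⟨S₁, S₂', a, hv, hL, -, -⟩ := decode_cons hLK (hσ _ hLK.mem_covT)
  rw [mp_lf_of_le (by simp)] at hv
  simp only [length_rpre, lf, if_true] at hv
  have hxK : x K = a := hx.eq_of_mem hK (by simp [phi, resp0, ← hσdef, hv, fst_enc]) hL.mem
  have hS₁ : dec (σ (rpre x K)) = S₁ := by rw [hv, dec_enc _ _ (small_subset hL.sub₁)]
  subst hxK
  have hQ : QStrat 0 T (rpre x (K + 1)) S₁ := hL.qs _ (List.suffix_refl _) (by simp)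
  have h₂ : rpre x (K + 2) ∈ S₁ := hQ.full hQ.base (by simp; omega) (hx.1 (K + 2))
  have hphi : ∀ n ≥ K + 2, phi K T D 0 σ' (rpre x n) =
      if ∃ u, FirstHit D (rpre x (K + 2)) (rpre x n) u then
        σ (mp (lf K S₁ (Cone T (rpre x (K + 2))
          (Classical.epsilon (FirstHit D (rpre x (K + 2)) (rpre x n))))) (rpre x n))
      else if rpre x n ∈ Safe 0 S₁ D (rpre x (K + 2)) then
        σ (mp (lf K S₁ (Safe 0 S₁ D (rpre x (K + 2)))) (rpre x n))
      else forceMove 0 S₁ D (rpre x n) := by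
    intro n hn
    have e₁ : ¬ n < K := by omega
    have e₂ : n ≠ K := by omega
    simp only [phi, resp0, length_rpre, sfx_rpre x hn, sfx_rpre x (show K ≤ n by omega), if_true,
      if_neg e₁, if_neg e₂, ← hσdef, hS₁]
  set r := rpre x (K + 2) with hr
  set Q := Safe 0 S₁ D r with hQdef
  have hAv : ∀ {q}, q ∈ Q → Avoids D S₁ r Q := fun {q} hq =>
    ⟨safe_qstrat (by omega) h₂ (hq.2.2 _ (List.suffix_refl _) hq.2.1) (fun q hq _ => hQ.ext hq)
      (fun a q hq hr => hQ.tail hq ((rpre_suffix x (by omega)).trans hr)),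
      fun q hq => notMem_of_safe hq⟩
  have step : ∀ n ≥ K + 2, (∀ j, K + 2 ≤ j → j ≤ n → rpre x j ∉ D) → rpre x n ∈ S₁ →
      rpre x (n + 1) ∈ S₁ ∧
      (n % 2 = 0 → rpre x n ∈ Q →
        rpre x (n + 1) ∈ Q ∧ x n = σ (mp (lf K S₁ Q) (rpre x n))) ∧
      (n % 2 = 0 → rpre x n ∉ Q → x n = forceMove 0 S₁ D (rpre x n)) := by
    intro n hn hD hm
    by_cases hi : n % 2 = 0
    · have hp := hphi n hn
      rw [if_neg (not_firstHit hD)] at hp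
      by_cases hs : rpre x n ∈ Q
      · rw [if_pos hs] at hp
        have hL := legal_rpre (hx.1 n) hQ h₂ (.inr (hAv hs)) hs
        have hL' := decode_long hL (hσ _ hL.mem_covT) (by simpa using hn)
        have e := hx.eq_of_mem hi hp hL'.mem
        have := (hL'.opt r ((rpre_suffix x hn).trans (List.suffix_cons _ _)) (by simp [hr])).2.2
        rw [← e] at this
        exact ⟨this.1, fun _ _ => ⟨this, e⟩, fun _ h => absurd hs h⟩
      · rw [if_neg hs] at hp
        have hf := (forceMove_spec (U := D) (p := rpre x n) (i := 0) (by simpa using hi)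
          (hQ.ext hm)).1
        have e := hx.eq_of_mem hi hp (hQ.sub hf)
        rw [← e] at hf
        exact ⟨hf, fun _ h => absurd h hs, fun _ _ => e⟩
    · exact ⟨hQ.full hm (by simpa using hi) (hx.1 (n + 1)), fun h => absurd h hi,
        fun h => absurd h hi⟩
  by_cases hhit : ∃ n, K + 2 ≤ n ∧ rpre x n ∈ D
  · set n₁ := Nat.find hhit with hn₁
    obtain ⟨hn₁K, hn₁D⟩ := Nat.find_spec hhit
    rw [← hn₁] at hn₁K hn₁D
    have hmin : ∀ j, K + 2 ≤ j → j < n₁ → rpre x j ∉ D := fun j hj hlt h =>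
      Nat.find_min hhit hlt ⟨hj, h⟩
    have hmem : ∀ n ≥ K + 2, n ≤ n₁ → rpre x n ∈ S₁ := by
      intro n hn
      induction n, hn using Nat.le_induction with
      | base => exact fun _ => h₂
      | succ n hn ih =>
        exact fun hle => (step n hn (fun j hj hjn => hmin j hj (by omega)) (ih (by omega))).1
    have hO : Hits T D S₁ r (Cone T r (rpre x n₁)) :=
      ⟨_, hmem n₁ hn₁K le_rfl, hn₁D, rpre_suffix x hn₁K, rfl⟩
    have hL : ∀ n ≥ K + 2, Legal K T D S₁ (Cone T r (rpre x n₁)) (rpre x n) := fun n hn =>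
      legal_rpre (hx.1 n) hQ h₂ (.inl hO) (rpre_mem_cone (hx.1 n) hn)
    refine exists_lift hT hx hφ hL fun n hn hi => ?_
    rcases (show n = K ∨ K + 2 ≤ n by omega) with rfl | hn
    · rw [mp_lf_of_le (by simp)]
      simp only [lf, if_true]
      exact hv.symm
    · have hL' := decode_long (hL n hn) (hσ _ (hL n hn).mem_covT) (by simpa using hn)
      rw [lf, if_neg (by omega), if_neg (by omega)]
      rcases lt_or_ge n n₁ with hlt | hge
      · exact eq_of_mem_cone hlt (hL'.opt r ((rpre_suffix x hn).trans (List.suffix_cons _ _))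
          (by simp [hr])).2.2
      · have hF : FirstHit D r (rpre x n) = (· = rpre x n₁) := funext fun u => propext
          (firstHit_iff hn₁D hn₁K hmin hge)
        have hp := hphi n hn
        rw [hF, if_pos ⟨_, rfl⟩, Classical.epsilon_singleton] at hp
        exact hx.eq_of_mem hi hp hL'.mem
  · push Not at hhit
    have hmem : ∀ n ≥ K + 2, rpre x n ∈ S₁ := by
      intro n hn
      induction n, hn using Nat.le_induction with
      | base => exact h₂
      | succ n hn ih => exact (step n hn (fun j hj _ => hhit j hj) ih).1
    by_cases hsafe : ∀ n ≥ K + 2, rpre x n ∈ Q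
    · have hL : ∀ n ≥ K + 2, Legal K T D S₁ Q (rpre x n) := fun n hn =>
        legal_rpre (hx.1 n) hQ h₂ (.inr (hAv (hsafe n hn))) (hsafe n hn)
      refine exists_lift hT hx hφ hL fun n hn hi => ?_
      rcases (show n = K ∨ K + 2 ≤ n by omega) with rfl | hn
      · rw [mp_lf_of_le (by simp)]
        simp only [lf, if_true]
        exact hv.symm
      · rw [lf, if_neg (by omega), if_neg (by omega)]
        exact ((step n hn (fun j hj _ => hhit j hj) (hmem n hn)).2.1 hi (hsafe n hn)).2
    · push Not at hsafe
      obtain ⟨n, hn, hns⟩ := hsafe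
      have : ∃ j, K + 2 ≤ j ∧ rpre x j ∈ Win 0 S₁ D := by
        by_contra! hcon
        refine hns ⟨hmem n hn, rpre_suffix x hn, fun q hq hq' => ?_⟩
        rw [eq_rpre_of_suffix hq']
        exact hcon _ (by simpa [hr] using hq.length_le)
      obtain ⟨j, hj, hjW⟩ := this
      obtain ⟨l, hl, hlD⟩ := force_hits (fun n hn => hmem n (by omega)) hjW fun n hn hi =>
        (step n (by omega) (fun j hj _ => hhit j hj) (hmem n (by omega))).2.2 hi fun h =>
          h.2.2 _ (rpre_suffix x hj) (rpre_suffix x hn) hjW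
      exact absurd hlD (hhit l (by omega))

theorem lift1 [Small.{u} T] (hT : IsTree T) (hK : K % 2 = 0) {σ' : List V → V} {x : ℕ → V}
    (hx : Cons T 1 (phi K T D 1 σ') x) :
    ∃ x', Cons (covT K T D) 1 σ' x' ∧ mpω (unlf K) x' = x := by
  classical
  set σ := leg (covT K T D) σ' with hσdef
  have hσ : ∀ q ∈ covT K T D, σ q :: q ∈ covT K T D := fun q hq =>
    leg_mem (covT_isTree hT) σ' hq
  have hφ : ∀ p : List V, p.length < K → phi K T D 1 σ' p = σ' p := fun p hp => by
    simp [phi, hp]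
  have hphi : ∀ n ≥ K + 1, phi K T D 1 σ' (rpre x n) =
      resp1 K T D σ (rpre x n) := by
    intro n hn
    simp [phi, ← hσdef]
    omega
  simp only [resp1] at hphi
  have hphi' : ∀ n ≥ K + 1, _ := fun n hn => by
    have := hphi n hn
    rw [sfx_rpre x hn, length_rpre] at this
    exact this
  clear hphi
  set r := rpre x (K + 1) with hr
  set U := {u | ∃ S, Wit K T D σ r u S} with hU
  set Q := Safe 1 T U r with hQdef
  have hext : ∀ q ∈ T, ∃ a, a :: q ∈ T := fun q hq => hT.ext hq
  by_cases hhit : ∃ n, K + 1 ≤ n ∧ rpre x n ∈ U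
  · set n₁ := Nat.find hhit with hn₁
    obtain ⟨hn₁K, hn₁U⟩ := Nat.find_spec hhit
    rw [← hn₁] at hn₁K hn₁U
    have hmin : ∀ j, K + 1 ≤ j → j < n₁ → rpre x j ∉ U := fun j hj hlt h =>
      Nat.find_min hhit hlt ⟨hj, h⟩
    have hW := Classical.epsilon_spec hn₁U
    set S₁ := Classical.epsilon (Wit K T D σ r (rpre x n₁)) with hS₁
    obtain ⟨hQ, huS, huD, b, hb, hbσ⟩ := hW
    have hbr := eq_rpre_of_suffix hb
    simp only [List.length_cons, hr, length_rpre] at hbr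
    rw [← hr] at hbr
    have hn₁K' : K + 2 ≤ n₁ := by
      have := hb.length_le
      have h' : K + 1 < n₁ := by simpa [hr] using this
      omega
    rw [hbr] at hbσ hb
    have hbx : b = x (K + 1) := by
      simp only [rpre, List.cons.injEq] at hbr
      exact hbr.1
    have h₂ : rpre x (K + 2) ∈ S₁ := hQ.suffix huS hb (rpre_suffix x (by omega))
    have hO : Hits T D S₁ (rpre x (K + 2)) (Cone T (rpre x (K + 2)) (rpre x n₁)) :=
      ⟨_, huS, huD, hb, rfl⟩
    have hL : ∀ n ≥ K + 2,
        Legal K T D S₁ (Cone T (rpre x (K + 2)) (rpre x n₁)) (rpre x n) := fun n hn =>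
      legal_rpre (hx.1 n) hQ h₂ (.inl hO) (rpre_mem_cone (hx.1 n) hn)
    refine exists_lift hT hx hφ hL fun n hn hi => ?_
    rcases (show n = K + 1 ∨ K + 2 ≤ n by omega) with rfl | hn
    · rw [← hr, mp_lf_congr (S₁' := S₁) (S₂' := ∅) (fun _ => rfl) (by simp [hr]), ← hσdef, hbσ,
        lf, if_neg (by omega), if_pos rfl, hbx]
    · have hL' := decode_long (hL n hn) (hσ _ (hL n hn).mem_covT) (by simpa using hn)
      rw [lf, if_neg (by omega), if_neg (by omega)]
      rcases lt_or_ge n n₁ with hlt | hge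
      · exact eq_of_mem_cone hlt (hL'.opt _ ((rpre_suffix x hn).trans (List.suffix_cons _ _))
          (by simp)).2.2
      · have hF : FirstHit U r (rpre x n) = (· = rpre x n₁) := funext fun u => propext
          (firstHit_iff hn₁U hn₁K hmin hge)
        have hp := hphi' n (by omega)
        rw [hF, if_pos ⟨_, rfl⟩, Classical.epsilon_singleton, sfx_rpre x hn] at hp
        exact hx.eq_of_mem hi hp hL'.mem
  · push Not at hhit
    by_cases hsafe : ∀ n ≥ K + 1, rpre x n ∈ Q
    · have hQ : QStrat 0 T r Q := safe_qstrat (i := 1) (by omega) (hx.1 _)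
        ((hsafe _ le_rfl).2.2 _ (List.suffix_refl _) (List.suffix_refl _))
        (fun q hq _ => hext q hq) (fun a q hq _ => hT.tail hq)
      have hLr : Legal K T D Q ∅ r := legal_succ (by simp [hr]) hQ
      obtain ⟨S₁', S₂, a, hv, hL, hS, -⟩ := decode_cons hLr (hσ _ hLr.mem_covT)
      obtain rfl := hS (by simp [hr])
      simp only [hr, length_rpre, lf, if_true, if_neg (show K + 1 ≠ K by omega)] at hv
      rw [← hr] at hv
      have hp : ∀ n ≥ K + 1, phi K T D 1 σ' (rpre x n) =
          unlf K n (σ (mp (lf K Q S₂) (rpre x n))) := by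
        intro n hn
        have := hphi' n hn
        rw [if_neg (not_firstHit fun j hj _ => hhit j hj), if_pos (hsafe n hn)] at this
        rw [this]
        change unlf K n (σ (mp (lf K Q (dec (σ (mp (lf K Q ∅) r)))) (rpre x n))) = _
        rw [show dec (σ (mp (lf K Q ∅) r)) = S₂ by
          rw [hv]; exact dec_enc _ _ (small_subset hL.sub₂)]
      have hQr : mp (lf K Q S₂) r = mp (lf K Q ∅) r :=
        mp_lf_congr (fun _ => rfl) (by simp [hr])
      have hxa : x (K + 1) = a := by
        refine hx.eq_of_mem (by omega) ?_ hL.mem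
        rw [hp _ le_rfl, ← hr, hQr, hv, unlf, if_pos (.inr rfl), fst_enc]
      subst hxa
      obtain ⟨h₂, hO, hS₂⟩ := hL.opt _ (List.suffix_refl _) (by simp [hr])
      have hA : Avoids D Q (rpre x (K + 2)) S₂ := by
        refine hO.resolve_left ?_
        rintro ⟨u, huS, huD, hru, rfl⟩
        exact notMem_of_safe huS ⟨_, hQ, huS, huD, _, hru, hv⟩
      have hmem : ∀ n ≥ K + 2, rpre x n ∈ S₂ ∧
          (n % 2 = 1 → x n = σ (mp (lf K Q S₂) (rpre x n))) := by
        have move : ∀ n ≥ K + 2, rpre x n ∈ S₂ → n % 2 = 1 →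
            x n = σ (mp (lf K Q S₂) (rpre x n)) ∧ rpre x (n + 1) ∈ S₂ := by
          intro n hn hm hi
          have hL := legal_rpre (hx.1 n) hQ h₂ (.inr hA) hm
          have hL' := decode_long hL (hσ _ hL.mem_covT) (by simpa using hn)
          have e := hx.eq_of_mem hi (by
            rw [hp n (by omega), unlf, if_neg (by omega)]) hL'.mem
          have := (hL'.opt _ ((rpre_suffix x hn).trans (List.suffix_cons _ _)) (by simp)).2.2
          rw [← e] at this
          exact ⟨e, this⟩
        have hm : ∀ n ≥ K + 2, rpre x n ∈ S₂ := by
          intro n hn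
          induction n, hn using Nat.le_induction with
          | base => exact hS₂
          | succ n hn ih =>
            by_cases hi : n % 2 = 1
            · exact (move n hn ih hi).2
            · exact hA.1.full ih (by simpa using hi) (hsafe (n + 1) (by omega))
        exact fun n hn => ⟨hm n hn, fun hi => (move n hn (hm n hn) hi).1⟩
      refine exists_lift hT hx hφ (fun n hn => legal_rpre (hx.1 n) hQ h₂ (.inr hA)
        (hmem n hn).1) fun n hn hi => ?_
      rcases (show n = K + 1 ∨ K + 2 ≤ n by omega) with rfl | hn
      · rw [← hr, hQr, ← hσdef, hv, lf, if_neg (by omega), if_pos rfl]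
      · rw [lf, if_neg (by omega), if_neg (by omega)]
        exact (hmem n hn).2 hi
    · push Not at hsafe
      obtain ⟨n, hn, hns⟩ := hsafe
      have : ∃ j, K + 1 ≤ j ∧ rpre x j ∈ Win 1 T U := by
        by_contra! hcon
        refine hns ⟨hx.1 n, rpre_suffix x hn, fun q hq hq' => ?_⟩
        rw [eq_rpre_of_suffix hq']
        exact hcon _ (by simpa [hr] using hq.length_le)
      obtain ⟨j, hj, hjW⟩ := this
      obtain ⟨l, hl, hlU⟩ := force_hits (fun n _ => hx.1 n) hjW fun n hn hi => by
        have hp := hphi' n (by omega)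
        rw [if_neg (not_firstHit fun j hj _ => hhit j hj), if_neg fun h =>
          h.2.2 _ (rpre_suffix x hj) (rpre_suffix x hn) hjW] at hp
        exact hx.eq_of_mem hi hp (forceMove_spec (by simpa using hi) (hext _ (hx.1 n))).1
      exact absurd hlU (hhit l (by omega))

theorem covT_cov [Small.{u} T] (hT : IsTree T) (hK : K % 2 = 0) :
    Cov K T (covT K T D) (unlf K) (phi K T D) where
  agree p hp := covT_agree hp
  m_id n hn := funext fun a => if_neg (by omega)
  map := by
    rintro _ ⟨S₁, S₂, p, rfl, h⟩
    rw [mp_unlf_lf]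
    exact h.mem
  φ_id i σ p hp := by simp [phi, hp]
  loc := phi_loc
  lift i hi σ x hx := by
    rcases (show i = 0 ∨ i = 1 by omega) with rfl | rfl
    · exact lift0 hT hK hx
    · exact lift1 hT hK hx

end Strategies

section FiniteHorizon

variable {V : Type w} [Nonempty V] {T : Set (List V)}

theorem determined_of_horizon (hT : IsTree T) (N : ℕ) (B : Set (List V)) :
    (∃ σ, ∀ x, Cons T 0 σ x → rpre x N ∈ B) ∨ (∃ σ, ∀ x, Cons T 1 σ x → rpre x N ∉ B) := by
  set U := {p : List V | p.length = N ∧ p ∈ B} with hU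
  by_cases hW : [] ∈ Win 0 T U
  · refine .inl ⟨forceMove 0 T U, fun x hx => ?_⟩
    obtain ⟨n, -, hn, hB⟩ := force_hits (n₀ := 0) (fun n _ => hx.1 n) hW fun n _ hi => by
      rw [hx.2 n hi, leg_eq]
      exact (forceMove_spec (by simpa using hi) (hT.ext (hx.1 n))).1
    rw [length_rpre] at hn
    rwa [← hn]
  · have hS := safe_qstrat (by omega) hT.nil hW (fun q hq _ => hT.ext hq)
      fun a q h _ => hT.tail h
    refine .inr ⟨fun p => Classical.epsilon fun a => a :: p ∈ Safe 0 T U [], fun x hx hB => ?_⟩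
    suffices h : ∀ n, rpre x n ∈ Safe 0 T U [] from
      notMem_of_safe (h N) ⟨length_rpre x N, hB⟩
    intro n
    induction n with
    | zero => exact hS.base
    | succ n ih =>
      by_cases hn : n % 2 = 1
      · have he := Classical.epsilon_spec (hS.ext ih)
        have := hx.2 n hn
        rw [leg_eq (hS.sub he)] at this
        rw [rpre, this]
        exact he
      · exact hS.full ih (by simpa using hn) (hx.1 (n + 1))

end FiniteHorizon

section Unravel

variable {V : Type (u + 1)} [Nonempty V] {T : Set (List V)} {A : Set (ℕ → V)}

/-- The set of plays `A` can be made to depend on finitely many moves by passing to small covering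
trees. -/
def Unrav (T : Set (List V)) (A : Set (ℕ → V)) : Prop :=
  ∀ k, ∃ T' m φ N, ∃ B : Set (List V), IsTree T' ∧ Small.{u} T' ∧ Cov k T T' m φ ∧
    ∀ x, (∀ n, rpre x n ∈ T') → (mpω m x ∈ A ↔ rpre x N ∈ B)

/-- All preimages of `A` in small trees over `T` are unravelable. -/
def HUnrav (T : Set (List V)) (A : Set (ℕ → V)) : Prop :=
  ∀ (T' : Set (List V)) (m : ℕ → V → V), IsTree T' → Small.{u} T' → (∀ p ∈ T', mp m p ∈ T) → Unrav T' (mpω m ⁻¹' A)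

theorem HUnrav.unrav (h : HUnrav T A) (hT : IsTree T) [hs : Small.{u} T] : Unrav T A :=
  h T (fun _ => id) hT hs fun p hp => by rwa [mp_id fun _ _ => rfl]

theorem Unrav.compl (h : Unrav T A) : Unrav T Aᶜ := fun k => by
  obtain ⟨T', m, φ, N, B, hT, hs, hc, hB⟩ := h k
  exact ⟨T', m, φ, N, Bᶜ, hT, hs, hc, fun x hx => not_congr (hB x hx)⟩

theorem HUnrav.compl (h : HUnrav T A) : HUnrav T Aᶜ := fun T' m h₁ h₂ h₃ =>
  (h T' m h₁ h₂ h₃).compl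

theorem Unrav.determined (h : Unrav T A) :
    (∃ σ, ∀ x, Cons T 0 σ x → x ∈ A) ∨ (∃ σ, ∀ x, Cons T 1 σ x → x ∉ A) := by
  obtain ⟨T', m, φ, N, B, hT, -, hc, hB⟩ := h 0
  rcases determined_of_horizon hT N B with ⟨σ, hσ⟩ | ⟨σ, hσ⟩
  · refine .inl ⟨φ 0 σ, fun x hx => ?_⟩
    obtain ⟨y, hy, rfl⟩ := hc.lift 0 (by omega) σ x hx
    exact (hB y hy.1).2 (hσ y hy)
  · refine .inr ⟨φ 1 σ, fun x hx => ?_⟩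
    obtain ⟨y, hy, rfl⟩ := hc.lift 1 (by omega) σ x hx
    exact fun h => hσ y hy ((hB y hy.1).1 h)

variable [Coding.{u} V]

theorem unrav_open [Small.{u} T] (hT : IsTree T) (D : Set (List V)) :
    Unrav T {x | ∃ n, rpre x n ∈ D} := fun k => by
  set E := {q : List V | ∃ p ∈ D, p <:+ q} with hE
  obtain ⟨B, hB⟩ := covT_decided (K := 2 * k) (T := T) (D := E)
    fun p q ⟨r, hr, hrp⟩ hpq => ⟨r, hr, hrp.trans hpq⟩
  refine ⟨covT (2 * k) T E, _, _, 2 * k + 2, B, covT_isTree hT, small_covT,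
    (covT_cov hT (by omega)).mono (by omega), fun x hx => ?_⟩
  rw [← hB x hx]
  constructor
  · rintro ⟨n, hn⟩
    exact ⟨n, _, hn, List.suffix_refl _⟩
  · rintro ⟨n, p, hp, hpn⟩
    exact ⟨p.length, by rwa [← eq_rpre_of_suffix hpn]⟩

theorem hUnrav_open (T D : Set (List V)) : HUnrav T {x | ∃ n, rpre x n ∈ D} :=
  fun T' m h₁ h₂ _ => by
    have := unrav_open h₁ {p | mp m p ∈ D}
    simp only [Set.mem_ofPred_eq, ← rpre_mpω] at this
    exact this

theorem unrav_iUnion {A : ℕ → Set (ℕ → V)} (hT : IsTree T) [hs : Small.{u} T]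
    (hA : ∀ i, HUnrav T (A i)) : Unrav T (⋃ i, A i) := fun k => by
  let St := {s : Set (List V) × (ℕ → V → V) //
    IsTree s.1 ∧ Small.{u} s.1 ∧ ∀ p ∈ s.1, mp s.2 p ∈ T}
  have step : ∀ i (s : St), ∃ (s' : St) (m : ℕ → V → V)
      (φ : ℕ → (List V → V) → List V → V) (N : ℕ) (B : Set (List V)),
      (s'.1.2 = fun n => s.1.2 n ∘ m n) ∧ Cov (k + i) s.1.1 s'.1.1 m φ ∧
      ∀ x, (∀ n, rpre x n ∈ s'.1.1) → (mpω s.1.2 (mpω m x) ∈ A i ↔ rpre x N ∈ B) := by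
    rintro i ⟨⟨S, M⟩, h₁, h₂, h₃⟩
    obtain ⟨T', m, φ, N, B, hT', hs', hc, hB⟩ := hA i S M h₁ h₂ h₃ (k + i)
    exact ⟨⟨⟨T', fun n => M n ∘ m n⟩, hT', hs', fun p hp => by
      rw [← mp_mp]; exact h₃ _ (hc.map p hp)⟩, m, φ, N, B, rfl, hc, hB⟩
  choose nx m φ N B hM hc hB using step
  let S : ℕ → St := fun i => Nat.rec
    ⟨⟨T, fun _ => id⟩, hT, hs, fun p hp => by rwa [mp_id fun _ _ => rfl]⟩ nx i
  have hcS : ∀ i, Cov (k + i) (S i).1.1 (S (i + 1)).1.1 (m i (S i)) (φ i (S i)) :=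
    fun i => hc i (S i)
  have hMS : ∀ i n, (S i).1.2 n ∘ limM (fun i => m i (S i)) i n =
      limM (fun i => m i (S i)) 0 n := by
    intro i n
    induction i with
    | zero => rfl
    | succ i ih =>
      rw [← ih, limM_succ hcS i, show (S (i + 1)).1.2 = _ from hM i (S i)]
      rfl
  have hL : IsTree (limT fun i => (S i).1.1) := limT_isTree hcS fun i => (S i).2.1
  have hLs : Small.{u} (limT fun i => (S i).1.1) := by
    have := fun i => (S i).2.2.1
    refine small_subset (s := ⋃ i, (S i).1.1) fun p hp => Set.mem_iUnion.2 ⟨_, hp⟩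
  obtain ⟨T'', m'', φ'', N'', B'', hT'', hs'', hc'', hB''⟩ := unrav_open hL
    {p | ∃ i, p.length = N i (S i) ∧
      mp (limM (fun i => m i (S i)) (i + 1)) p ∈ B i (S i)} k
  refine ⟨T'', _, _, N'', B'', hT'', hs'', (Cov.limit hcS).comp hc'', fun x hx => ?_⟩
  rw [← hB'' x hx]
  change mpω (limM (fun i => m i (S i)) 0) (mpω m'' x) ∈ _ ↔ _
  have hy : ∀ n, rpre (mpω m'' x) n ∈ limT fun i => (S i).1.1 := fun n => by
    rw [rpre_mpω]; exact hc''.map _ (hx n)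
  generalize mpω m'' x = y at hy
  have key : ∀ i, mpω (limM (fun i => m i (S i)) 0) y ∈ A i ↔
      mp (limM (fun i => m i (S i)) (i + 1)) (rpre y (N i (S i))) ∈ B i (S i) := by
    intro i
    have := hB i (S i) (mpω (limM (fun i => m i (S i)) (i + 1)) y) fun n => by
      rw [rpre_mpω]; exact mp_limM_mem hcS (i + 1) (hy n)
    rw [← rpre_mpω, ← this]
    refine iff_of_eq (congrArg (· ∈ A i) (funext fun n => ?_))
    rw [mpω, ← hMS i n, limM_succ hcS i]
    rfl
  simp only [Set.mem_iUnion, key, Set.mem_ofPred_eq, length_rpre]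
  constructor
  · rintro ⟨i, hi⟩
    exact ⟨_, i, rfl, hi⟩
  · rintro ⟨n, i, rfl, hi⟩
    exact ⟨i, hi⟩

theorem hUnrav_iUnion {A : ℕ → Set (ℕ → V)} (hA : ∀ i, HUnrav T (A i)) :
    HUnrav T (⋃ i, A i) := fun T' m h₁ h₂ h₃ => by
  rw [Set.preimage_iUnion]
  refine unrav_iUnion h₁ fun i T'' m' h₁' h₂' h₃' => ?_
  exact hA i T'' (fun n => m n ∘ m' n) h₁' h₂' fun p hp => by
    rw [← mp_mp]; exact h₃ _ (h₃' p hp)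

end Unravel

section Borel

variable {C : Type*} [TopologicalSpace C]

theorem exists_rpre_of_isOpen {A : Set (ℕ → C)} (hA : IsOpen A) {y : ℕ → C} (hy : y ∈ A) :
    ∃ n, ∀ z, rpre z n = rpre y n → z ∈ A := by
  obtain ⟨I, W, hW, hsub⟩ := isOpen_pi_iff.1 hA y hy
  refine ⟨I.sup id + 1, fun z hz => hsub fun i hi => ?_⟩
  have h : i < I.sup id + 1 := Nat.lt_succ_of_le (Finset.le_sup (f := id) hi)
  rw [rpre_inj hz i h]
  exact (hW i hi).2

variable {V : Type (u + 1)} [Nonempty V] [Coding.{u} V]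

theorem hUnrav_borel (T : Set (List V)) {F : (ℕ → V) → ℕ → C}
    (hF : ∀ n, ∃ k, ∀ x y, rpre x k = rpre y k → rpre (F x) n = rpre (F y) n)
    {A : Set (ℕ → C)} (hA : @MeasurableSet _ (borel (ℕ → C)) A) : HUnrav T (F ⁻¹' A) := by
  induction A, hA using MeasurableSpace.generateFrom_induction with
  | hC A hA _ =>
    convert hUnrav_open T {p : List V | ∀ y, rpre y p.length = p → F y ∈ A} using 1
    ext x
    simp only [Set.mem_ofPred_eq, length_rpre, Set.mem_preimage]
    refine ⟨fun h => ?_, fun ⟨n, hn⟩ => hn _ rfl⟩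
    obtain ⟨n, hn⟩ := exists_rpre_of_isOpen hA h
    obtain ⟨k, hk⟩ := hF n
    exact ⟨k, fun y hy => hn _ (hk _ _ hy)⟩
  | empty => exact fun T' m h₁ h₂ _ k => ⟨T', fun _ => id, fun _ σ => σ, 0, ∅, h₁, h₂,
    ⟨fun _ _ => Iff.rfl, fun _ _ => rfl, fun p hp => by rwa [mp_id fun _ _ => rfl],
      fun _ _ _ _ => rfl, fun _ _ _ _ h => h, fun _ _ σ x hx => ⟨x, hx, rfl⟩⟩, fun x _ => Iff.rfl⟩
  | compl A _ ih => exact ih.compl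
  | iUnion A _ ih =>
    rw [Set.preimage_iUnion]
    exact hUnrav_iUnion ih

end Borel

section Moves

/-- Moves in `C`, with codes of small families of positions attached. -/
inductive Moves (C : Type u) : Type (u + 1)
  | base : C → Moves C
  | mk : Moves C → (α : Type u) → (α → List (Moves C)) → Moves C

namespace Moves

variable {C : Type u}

/-- The move to which the last code has been attached. -/
def fst : Moves C → Moves C
  | base c => base c
  | mk a _ _ => a

/-- The set coded by the last code attached to a move. -/
def dec : Moves C → Set (List (Moves C))
  | base _ => ∅
  | mk _ _ f => Set.range f

/-- Attach a code of a small set to a move. -/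
noncomputable def enc (a : Moves C) (S : Set (List (Moves C))) : Moves C :=
  open Classical in
  if _ : Small.{u} S then mk a (Shrink.{u} S) fun s => ((equivShrink S).symm s).1
  else mk a PEmpty PEmpty.elim

noncomputable instance : Coding.{u} (Moves C) where
  fst := fst
  dec := dec
  enc := enc
  fst_enc a S := by unfold enc; split_ifs <;> rfl
  dec_enc a S hS := by
    rw [enc, dif_pos hS]
    ext p
    constructor
    · rintro ⟨s, rfl⟩
      exact Subtype.prop _
    · exact fun hp => ⟨equivShrink S ⟨p, hp⟩, by simp⟩

variable [Nonempty C]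

instance : Nonempty (Moves C) := ⟨base (Classical.arbitrary C)⟩

/-- The element of `C` underlying a move. -/
noncomputable def val : Moves C → C
  | base c => c
  | mk _ _ _ => Classical.arbitrary C

end Moves

/-- The positions without codes. -/
def baseT (C : Type u) : Set (List (Moves C)) := {p | ∀ a ∈ p, ∃ c, a = Moves.base c}

variable {C : Type u} [Nonempty C]

theorem baseT_isTree : IsTree (baseT C) where
  nil := by simp [baseT]
  tail h a ha := h a (List.mem_cons_of_mem _ ha)
  ext {p} h := ⟨.base (Classical.arbitrary C), fun a ha => by
    rcases List.mem_cons.1 ha with rfl | ha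
    · exact ⟨_, rfl⟩
    · exact h a ha⟩

omit [Nonempty C] in
theorem small_baseT : Small.{u} (baseT C) := by
  refine small_subset (s := Set.range fun l : List C => l.map Moves.base) fun p hp => ?_
  induction p with
  | nil => exact ⟨[], rfl⟩
  | cons a p ih =>
    obtain ⟨l, hl⟩ := ih fun a ha => hp a (List.mem_cons_of_mem _ ha)
    obtain ⟨c, rfl⟩ := hp a List.mem_cons_self
    exact ⟨c :: l, by simpa using hl⟩

omit [Nonempty C] in
theorem cons_base_mem {p : List (Moves C)} (h : p ∈ baseT C) (c : C) :
    Moves.base c :: p ∈ baseT C := fun a ha => by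
  rcases List.mem_cons.1 ha with rfl | ha
  · exact ⟨c, rfl⟩
  · exact h a ha

end Moves

section Alternation

variable {C : Type u} [Nonempty C] (d : List C → Bool)

/-- The position after `n` moves of the game with turn function `d`, when the players take turns to
propose moves and the proposal of the player whose turn it is gets played. -/
noncomputable def altH (x : ℕ → Moves C) : ℕ → List C
  | 0 => []
  | n + 1 => (x (if d (altH x n) then 2 * n else 2 * n + 1)).val :: altH x n

/-- The play resulting from alternating proposals. -/
noncomputable def alt (x : ℕ → Moves C) (n : ℕ) : C :=
  (x (if d (altH d x n) then 2 * n else 2 * n + 1)).val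

theorem rpre_alt (x : ℕ → Moves C) (n : ℕ) : rpre (alt d x) n = altH d x n := by
  induction n with
  | zero => rfl
  | succ n ih => rw [rpre, ih]; rfl

theorem alt_local (n : ℕ) {x y : ℕ → Moves C} (h : rpre x (2 * n) = rpre y (2 * n)) :
    rpre (alt d x) n = rpre (alt d y) n := by
  rw [rpre_alt, rpre_alt]
  induction n with
  | zero => rfl
  | succ n ih =>
    have h' := rpre_inj h
    rw [altH, altH, ih (rpre_congr fun j hj => h' j (by omega)), h' _ (by split_ifs <;> omega)]

theorem alt_eq {x : ℕ → Moves C} {z : ℕ → C}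
    (h : ∀ n, z n = (x (if d (rpre z n) then 2 * n else 2 * n + 1)).val) : alt d x = z := by
  have H : ∀ n, altH d x n = rpre z n := fun n => by
    induction n with
    | zero => rfl
    | succ n ih => rw [altH, ih, ← h n]; rfl
  funext n
  rw [alt, H, ← h n]

variable {d} {A : Set (ℕ → C)}

theorem wins_true_of_alt {σ : List (Moves C) → Moves C}
    (h : ∀ x, Cons (baseT C) 0 σ x → alt d x ∈ A) :
    ∃ s : List C → C, ∀ z, (∀ n, d (rpre z n) = true → z n = s (rpre z n)) → z ∈ A := by
  let Y : List C → List (Moves C) := fun h =>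
    List.rec [] (fun c _ Y => .base c :: leg (baseT C) σ Y :: Y) h
  refine ⟨fun h => (leg (baseT C) σ (Y h)).val, fun z hz => ?_⟩
  let x : ℕ → Moves C := fun n =>
    if n % 2 = 0 then leg (baseT C) σ (Y (rpre z (n / 2))) else .base (z (n / 2))
  have hx₀ : ∀ n, x (2 * n) = leg (baseT C) σ (Y (rpre z n)) := fun n => by simp [x]
  have hx₁ : ∀ n, x (2 * n + 1) = .base (z n) := fun n => by
    simp [x, show (2 * n + 1) / 2 = n by omega]
  have hY : ∀ n, rpre x (2 * n) = Y (rpre z n) := fun n => by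
    induction n with
    | zero => rfl
    | succ n ih =>
      rw [show 2 * (n + 1) = 2 * n + 1 + 1 by ring, rpre, rpre, hx₀, hx₁, ih]
      rfl
  have hmem : ∀ n, rpre x (2 * n) ∈ baseT C := fun n => by
    induction n with
    | zero => exact baseT_isTree.nil
    | succ n ih =>
      rw [show 2 * (n + 1) = 2 * n + 1 + 1 by ring, rpre, rpre, hx₀, hx₁]
      refine cons_base_mem ?_ _
      rw [← hY]
      exact leg_mem baseT_isTree σ ih
  rw [← alt_eq d (x := x) (z := z) fun n => ?_]
  · refine h x ⟨fun n => baseT_isTree.suffix (hmem n) (rpre_suffix x (by omega)), fun n hn => ?_⟩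
    obtain ⟨m, rfl⟩ : ∃ m, n = 2 * m := ⟨n / 2, by omega⟩
    rw [hx₀, hY]
  · split_ifs with h
    · rw [hx₀, hz n h]
    · rw [hx₁]; rfl

theorem wins_false_of_alt {σ : List (Moves C) → Moves C}
    (h : ∀ x, Cons (baseT C) 1 σ x → alt d x ∈ A) :
    ∃ s : List C → C, ∀ z, (∀ n, d (rpre z n) = false → z n = s (rpre z n)) → z ∈ A := by
  let I : List C → C → Moves C := fun h c => .base (if d h then c else Classical.arbitrary C)
  let Y : List C → List (Moves C) := fun h =>
    List.rec [] (fun c h Y => leg (baseT C) σ (I h c :: Y) :: I h c :: Y) h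
  refine ⟨fun h => (leg (baseT C) σ (.base (Classical.arbitrary C) :: Y h)).val, fun z hz => ?_⟩
  let x : ℕ → Moves C := fun n =>
    if n % 2 = 0 then I (rpre z (n / 2)) (z (n / 2))
    else leg (baseT C) σ (I (rpre z (n / 2)) (z (n / 2)) :: Y (rpre z (n / 2)))
  have hx₀ : ∀ n, x (2 * n) = I (rpre z n) (z n) := fun n => by simp [x]
  have hx₁ : ∀ n, x (2 * n + 1) = leg (baseT C) σ (I (rpre z n) (z n) :: Y (rpre z n)) :=
    fun n => by simp [x, show (2 * n + 1) / 2 = n by omega]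
  have hY : ∀ n, rpre x (2 * n) = Y (rpre z n) := fun n => by
    induction n with
    | zero => rfl
    | succ n ih =>
      rw [show 2 * (n + 1) = 2 * n + 1 + 1 by ring, rpre, rpre, hx₀, hx₁, ih]
      rfl
  have hmem : ∀ n, rpre x (2 * n) ∈ baseT C := fun n => by
    induction n with
    | zero => exact baseT_isTree.nil
    | succ n ih =>
      rw [show 2 * (n + 1) = 2 * n + 1 + 1 by ring, rpre, rpre, hx₀, hx₁, ← hY]
      exact leg_mem baseT_isTree σ (cons_base_mem ih _)
  rw [← alt_eq d (x := x) (z := z) fun n => ?_]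
  · refine h x ⟨fun n => baseT_isTree.suffix (hmem n) (rpre_suffix x (by omega)), fun n hn => ?_⟩
    obtain ⟨m, rfl⟩ : ∃ m, n = 2 * m + 1 := ⟨n / 2, by omega⟩
    rw [hx₁, rpre, hx₀, hY]
  · split_ifs with h
    · rw [hx₀]; simp only [I, h, if_true]; rfl
    · rw [hx₁, hz n (by simpa using h)]
      simp only [I, h]
      rfl

theorem borel_determined [TopologicalSpace C] (d : List C → Bool)
    (hA : @MeasurableSet _ (borel (ℕ → C)) A) :
    (∃ s : List C → C, ∀ z, (∀ n, d (rpre z n) = true → z n = s (rpre z n)) → z ∈ A) ∨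
    (∃ s : List C → C, ∀ z, (∀ n, d (rpre z n) = false → z n = s (rpre z n)) → z ∈ Aᶜ) := by
  have := small_baseT (C := C)
  rcases ((hUnrav_borel (baseT C) (F := alt d) (fun n => ⟨2 * n, fun _ _ => alt_local d n⟩)
    hA).unrav baseT_isTree).determined with ⟨σ, hσ⟩ | ⟨σ, hσ⟩
  · exact .inl (wins_true_of_alt hσ)
  · exact .inr (wins_false_of_alt hσ)

end Alternation

section Subgames

variable {C : Type u} {d : List C → Bool} {b : Bool} {A : Set (ℕ → C)}

/-- From the position with index `N` on, the play `z` is consistent with the strategy `s` of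
player `b`. -/
def Follows (d : List C → Bool) (b : Bool) (s : List C → C) (N : ℕ) (z : ℕ → C) : Prop :=
  ∀ n ≥ N, d (rpre z n) = b → z n = s (rpre z n)

/-- The strategy `s` of player `b` guarantees `A` from the position `γ` on. -/
def Ensures (d : List C → Bool) (b : Bool) (s : List C → C) (γ : List C) (A : Set (ℕ → C)) :
    Prop :=
  ∀ z, rpre z γ.length = γ → Follows d b s γ.length z → z ∈ A

/-- The infinite sequence extending the position `γ` by `y`. -/
def app (γ : List C) (y : ℕ → C) (n : ℕ) : C :=
  if h : n < γ.length then γ.reverse[n]'(by simpa using h) else y (n - γ.length)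

theorem app_shift {γ : List C} {z : ℕ → C} (h : rpre z γ.length = γ) :
    app γ (fun n => z (n + γ.length)) = z := by
  have key : ∀ N n (hn : n < N), (rpre z N).reverse[n]'(by simpa using hn) = z n := by
    intro N
    induction N with
    | zero => intro n hn; omega
    | succ N ih =>
      intro n hn
      simp only [rpre, List.reverse_cons, List.getElem_append, List.length_reverse, length_rpre]
      split_ifs with h
      · exact ih n h
      · simp [show n = N by omega]
  funext n
  unfold app
  split_ifs with hn
  · rw [← key _ n hn]
    simp only [h]
  · exact congrArg z (Nat.sub_add_cancel (by omega))

theorem rpre_add {γ : List C} {z : ℕ → C} (h : rpre z γ.length = γ) (n : ℕ) :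
    rpre z (n + γ.length) = rpre (fun n => z (n + γ.length)) n ++ γ := by
  induction n with
  | zero => simpa [rpre] using h
  | succ n ih => rw [show n + 1 + γ.length = n + γ.length + 1 by ring, rpre, ih]; rfl

theorem Ensures.of_shift {s : List C → C} {γ : List C}
    (h : ∀ y, (∀ n, d (rpre y n ++ γ) = b → y n = s (rpre y n)) → app γ y ∈ A) :
    Ensures d b (fun p => s (p.take (p.length - γ.length))) γ A := fun z hz hs => by
  rw [← app_shift hz]
  refine h _ fun n hn => ?_
  rw [← rpre_add hz] at hn
  have := hs _ (by omega) hn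
  rw [this, rpre_add hz]
  simp

variable [Nonempty C] [TopologicalSpace C]

theorem exists_ensures (d : List C → Bool) (hA : @MeasurableSet _ (borel (ℕ → C)) A)
    (γ : List C) : (∃ s, Ensures d true s γ A) ∨ ∃ s, Ensures d false s γ Aᶜ := by
  borelize (ℕ → C)
  have hc : Continuous (app γ) := continuous_pi fun n => by
    unfold app
    split_ifs
    · exact continuous_const
    · exact continuous_apply _
  rcases borel_determined (fun p => d (p ++ γ)) (hc.measurable hA) with ⟨s, hs⟩ | ⟨s, hs⟩
  · exact .inl ⟨_, .of_shift hs⟩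
  · exact .inr ⟨_, .of_shift hs⟩

end Subgames

section Uniform

variable {C : Type u} {d : List C → Bool} {b : Bool}

/-- The position at which the strategy in force at a given position was adopted: the family of
strategies `s` is followed until a deviation occurs or the value `val` changes. -/
noncomputable def origin (d : List C → Bool) (b : Bool) (val : List C → ℕ)
    (s : List C → List C → C) : List C → List C
  | [] => []
  | c :: h =>
    open Classical in
    if val (c :: h) = val (origin d b val s h) ∧ (d h = b → c = s (origin d b val s h) h) then
      origin d b val s h
    else c :: h

variable {val : List C → ℕ} {s : List C → List C → C}

theorem val_origin (h : List C) : val (origin d b val s h) = val h := by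
  cases h with
  | nil => rfl
  | cons c h =>
    unfold origin
    split_ifs with hc
    · exact hc.1.symm
    · rfl

theorem origin_spec (z : ℕ → C) (n : ℕ) :
    ∃ k ≤ n, origin d b val s (rpre z n) = rpre z k ∧
      ∀ m, k ≤ m → m < n → d (rpre z m) = b → z m = s (rpre z k) (rpre z m) := by
  induction n with
  | zero => exact ⟨0, le_rfl, rfl, fun m _ h => absurd h (by omega)⟩
  | succ n ih =>
    rw [rpre, origin]
    split_ifs with hc
    · obtain ⟨k, hk, he, hm⟩ := ih
      refine ⟨k, by omega, he, fun m h₁ h₂ h₃ => ?_⟩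
      rcases Nat.lt_succ_iff_lt_or_eq.1 h₂ with h₂ | rfl
      · exact hm m h₁ h₂ h₃
      · rw [← he]; exact hc.2 h₃
    · exact ⟨n + 1, le_rfl, rfl, fun m h₁ h₂ => absurd h₂ (by omega)⟩

theorem exists_uniform [Nonempty C] {v : (ℕ → C) → ℕ} {M : ℕ}
    (hM : ∀ γ j s, Ensures d b s γ {z | j ≤ v z} → j ≤ M) :
    ∃ σ : List C → C, ∀ γ j s, Ensures d b s γ {z | j ≤ v z} → Ensures d b σ γ {z | j ≤ v z} := by
  let J : List C → Set ℕ := fun γ => {j | ∃ s, Ensures d b s γ {z | j ≤ v z}}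
  have hJ : ∀ γ, BddAbove (J γ) := fun γ => ⟨M, fun j ⟨s, hs⟩ => hM γ j s hs⟩
  have hJ' : ∀ γ, sSup (J γ) ∈ J γ := fun γ =>
    Nat.sSup_mem ⟨0, fun _ => Classical.arbitrary C, fun _ _ _ => Nat.zero_le _⟩ (hJ γ)
  choose s hs using hJ'
  set val : List C → ℕ := fun γ => sSup (J γ) with hval
  set g := origin d b val s with hg
  have hvg : ∀ h, val (g h) = val h := val_origin
  refine ⟨fun h => s (g h) h, fun γ j t ht z hz hσ => ?_⟩
  set N := γ.length with hN
  have hmono : ∀ n ≥ N, val (g (rpre z n)) ≤ val (g (rpre z (n + 1))) := by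
    intro n hn
    obtain ⟨k, hk, he, hm⟩ := origin_spec (d := d) (b := b) (val := val) (s := s) z n
    rw [← hg] at he
    rw [hvg (rpre z (n + 1))]
    refine le_csSup (hJ _) ⟨s (g (rpre z n)), fun w hw hw' => ?_⟩
    rw [length_rpre] at hw hw'
    have hwz := rpre_inj hw
    have hr : ∀ m ≤ n + 1, rpre w m = rpre z m := fun m hm =>
      rpre_congr fun j hj => hwz j (by omega)
    refine hs _ w ?_ ?_
    · rw [he, length_rpre, hr k (by omega)]
    · rw [he, length_rpre]
      intro m hkm hdm
      rcases lt_or_ge m (n + 1) with hlt | hge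
      · rw [hr m (by omega)] at hdm ⊢
        rw [hwz m hlt]
        rcases Nat.lt_succ_iff_lt_or_eq.1 hlt with hlt | rfl
        · exact hm m hkm hlt hdm
        · rw [← he]; exact hσ m hn hdm
      · rw [← he]; exact hw' m hge hdm
  have hstep : ∀ n ≥ N, val (g (rpre z (n + 1))) = val (g (rpre z n)) →
      g (rpre z (n + 1)) = g (rpre z n) := by
    intro n hn h
    rw [hvg (rpre z (n + 1))] at h
    rw [hg, rpre, origin, if_pos ⟨h, fun hd => hσ n hn hd⟩]
  obtain ⟨n₀, hn₀, hmax⟩ : ∃ n₀ ≥ N, ∀ n ≥ N, val (g (rpre z n)) ≤ val (g (rpre z n₀)) := by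
    have hb : BddAbove ((fun n => val (g (rpre z n))) '' Set.Ici N) := ⟨M, by
      rintro _ ⟨n, -, rfl⟩
      exact hM _ _ _ (hs _)⟩
    obtain ⟨n₀, h₀, he⟩ := Nat.sSup_mem (Set.nonempty_Ici.image _) hb
    exact ⟨n₀, h₀, fun n hn => (le_csSup hb ⟨n, hn, rfl⟩).trans he.symm.le⟩
  have hge : ∀ n ≥ N, val (g (rpre z N)) ≤ val (g (rpre z n)) := fun n hn => by
    induction n, hn using Nat.le_induction with
    | base => exact le_rfl
    | succ n hn ih => exact ih.trans (hmono n hn)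
  have hconst : ∀ n ≥ n₀, g (rpre z n) = g (rpre z n₀) := fun n hn => by
    induction n, hn using Nat.le_induction with
    | base => rfl
    | succ n hn ih =>
      rw [hstep n (by omega) (le_antisymm (ih ▸ hmax (n + 1) (by omega)) (hmono n (by omega))), ih]
  obtain ⟨k, hk, he, hm⟩ := origin_spec (d := d) (b := b) (val := val) (s := s) z n₀
  rw [← hg] at he
  have hfin := hs (g (rpre z n₀)) z (by rw [he, length_rpre]) fun m hkm hdm => by
    rw [he, length_rpre] at hkm
    rcases lt_or_ge m n₀ with hlt | hge
    · rw [he]; exact hm m hkm hlt hdm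
    · rw [← hconst m hge]; exact hσ m (by omega) hdm
  refine le_trans ?_ (le_trans (hge n₀ hn₀) hfin)
  rw [hvg (rpre z N), hz]
  exact le_csSup (hJ γ) ⟨t, ht⟩

end Uniform

section Play

open SeqGame

variable {C : Type u}

theorem hist_eq (σ : List C → C) (γ : List C) (n : ℕ) :
    hist σ γ n = (rpre (play σ γ) n).reverse := by
  induction n with
  | zero => rfl
  | succ n ih => rw [rpre, List.reverse_cons, ← ih]; rfl

theorem rpre_play (σ : List C → C) (γ : List C) :
    rpre (play σ γ) γ.reverse.length = γ.reverse := by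
  rw [← List.reverse_inj, ← hist_eq, List.reverse_reverse, List.length_reverse]
  have key : ∀ n ≤ γ.length, hist σ γ n = γ.take n := by
    intro n
    induction n with
    | zero => intro _; rfl
    | succ n ih =>
      intro hn
      rw [hist, ih (by omega), dif_pos (by omega), List.take_add_one,
        List.getElem?_eq_getElem (by omega)]
      rfl
  rw [key _ le_rfl, List.take_length]

theorem play_eq (σ : List C → C) (γ : List C) {n : ℕ} (hn : γ.reverse.length ≤ n) :
    play σ γ n = σ (rpre (play σ γ) n).reverse := by
  rw [List.length_reverse] at hn
  rw [← hist_eq, play, dif_neg (by omega)]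

theorem Ensures.play {d : List C → Bool} {b : Bool} {s : List C → C} {γ : List C}
    {A : Set (ℕ → C)} (h : Ensures (fun p => d p.reverse) b s γ.reverse A) {σ : List C → C}
    (hσ : ∀ p, d p = b → σ p = s p.reverse) : play σ γ ∈ A :=
  h _ (rpre_play σ γ) fun n hn hd => by
    rw [play_eq σ γ hn, hσ _ hd, List.reverse_reverse]

end Play

end BorelDet

open SeqGame in
/-- a two-player zero-sum sequential game with Borel measurable payoff
function `f` into `[0,1]` (player `a` is `true`, maximizing `f`; player `b` is `false`,
maximizing `1 - f`) has an `ε`-subgame perfect equilibrium for every `ε > 0`. -/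
theorem stmt11 {C : Type*} [Nonempty C] [TopologicalSpace C] [DiscreteTopology C]
    (d : List C → Bool) (f : (ℕ → C) → ℝ)
    (hf01 : ∀ p : ℕ → C, f p ∈ Set.Icc (0 : ℝ) 1)
    (hmeas : @Measurable (ℕ → C) ℝ (borel (ℕ → C)) inferInstance f)
    (ε : ℝ) (hε : 0 < ε) :
    ∃ σ : List C → C, ∀ γ : List C,
      (∀ σ' : List C → C, Dev d true σ σ' → f (play σ' γ) ≤ f (play σ γ) + ε) ∧
      (∀ σ' : List C → C, Dev d false σ σ' → f (play σ γ) - ε ≤ f (play σ' γ)) := by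
  set v : (ℕ → C) → ℕ := fun z => ⌊f z / ε⌋₊ with hv
  have hle : ∀ j z, j ≤ v z ↔ j * ε ≤ f z := fun j z => by
    rw [hv, Nat.le_floor_iff (div_nonneg (hf01 z).1 hε.le), le_div_iff₀ hε]
  obtain ⟨M, hM⟩ : ∃ M, ∀ z, v z ≤ M :=
    ⟨⌊1 / ε⌋₊, fun z => Nat.floor_le_floor (by gcongr; exact (hf01 z).2)⟩
  set D : List C → Bool := fun p => d p.reverse with hD
  have bound : ∀ (b : Bool) (u : (ℕ → C) → ℕ), (∀ z, u z ≤ M) →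
      ∀ γ j s, BorelDet.Ensures D b s γ {z | j ≤ u z} → j ≤ M := fun b u hu γ j s h => by
    rw [← List.reverse_reverse γ] at h
    exact le_trans (h.play (σ := fun p => s p.reverse) fun _ _ => rfl) (hu _)
  obtain ⟨σ₁, hσ₁⟩ := BorelDet.exists_uniform (bound true v hM)
  obtain ⟨σ₀, hσ₀⟩ := BorelDet.exists_uniform (bound false (fun z => M - v z) fun z => Nat.sub_le _ _)
  have hmeas' : ∀ j, @MeasurableSet _ (borel (ℕ → C)) {z | j ≤ v z} := fun j => by
    simp only [hle]
    exact hmeas measurableSet_Ici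
  set σ : List C → C := fun p => if d p then σ₁ p.reverse else σ₀ p.reverse with hσ
  have h₁ : ∀ p, d p = true → σ p = σ₁ p.reverse := fun p hp => if_pos hp
  have h₀ : ∀ p, d p = false → σ p = σ₀ p.reverse := fun p hp => by simp [hσ, hp]
  refine ⟨σ, fun γ => ?_⟩
  have hlt := fun z => (hle (v z + 1) z).not.1 (by omega)
  push_cast at hlt
  constructor
  · intro σ' hσ'
    have hs : v (play σ' γ) ≤ v (play σ γ) := by
      rcases BorelDet.exists_ensures D (hmeas' (v (play σ γ) + 1)) γ.reverse with ⟨s, hs⟩ | ⟨s, hs⟩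
      · have := (hσ₁ _ _ s hs).play h₁
        rw [Set.mem_ofPred_eq] at this
        omega
      · have hs' : BorelDet.Ensures D false s γ.reverse {z | M - v (play σ γ) ≤ M - v z} :=
          fun z hz hz' => by
            have := hs z hz hz'
            simp only [Set.mem_compl_iff, Set.mem_ofPred_eq] at this ⊢
            omega
        have := (hσ₀ _ _ s hs').play (σ := σ') fun p hp => by
          rw [hσ' p (by simp [hp]), h₀ p hp]
        rw [Set.mem_ofPred_eq] at this
        have := hM (play σ' γ)
        have := hM (play σ γ)
        omega
    have h := hlt (play σ' γ)
    have h' := (hle _ _).1 (le_refl (v (play σ γ)))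
    have : (v (play σ' γ) : ℝ) * ε ≤ v (play σ γ) * ε := by gcongr
    linarith
  · intro σ' hσ'
    have hs : v (play σ γ) ≤ v (play σ' γ) := by
      rcases BorelDet.exists_ensures D (hmeas' (v (play σ γ))) γ.reverse with ⟨s, hs⟩ | ⟨s, hs⟩
      · exact (hσ₁ _ _ s hs).play (σ := σ') fun p hp => by
          rw [hσ' p (by simp [hp]), h₁ p hp]
      · have hs' : BorelDet.Ensures D false s γ.reverse {z | M - v (play σ γ) + 1 ≤ M - v z} :=
          fun z hz hz' => by
            have := hs z hz hz'
            simp only [Set.mem_compl_iff, Set.mem_ofPred_eq] at this ⊢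
            have := hM (play σ γ)
            omega
        have := (hσ₀ _ _ s hs').play h₀
        rw [Set.mem_ofPred_eq] at this
        have := hM (play σ γ)
        omega
    have h := hlt (play σ γ)
    have h' := (hle _ _).1 hs
    linarith
end
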